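/- arXiv:1608.00231 — 5 statements merged into one kernel-verified Lean document; each statement's English description precedes it below -/
import Mathlib

section
/- For every finite group G and every field K of characteristic zero, the collection of normal subgroups of G that are nonideal-kernel witnesses over K has a greatest element: there exists a normal subgroup N₀ of G which is a nonideal-kernel witness over K such that every normal subgroup N of G which is a nonideal-kernel witness over K satisfies N ≤ N₀. -/
open scoped BigOperators

/-- The averaging element `e_N = (1/|N|) ∑_{n ∈ N} n` in the group algebra `K[G]`. -/
noncomputable def aveIdem (K : Type*) [Field K] {G : Type*} [Group G] (N : Subgroup G) :
    MonoidAlgebra K G :=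
  (Nat.card N : K)⁻¹ • ∑ᶠ n : N, MonoidAlgebra.of K G (n : G)

/-- `N` is a nonideal-kernel witness over `K`: every nilpotent element `x` of `K[G]`
satisfies `x * e_N = x`. -/
def IsNKW (K : Type*) [Field K] {G : Type*} [Group G] (N : Subgroup G) : Prop :=
  ∀ x : MonoidAlgebra K G, IsNilpotent x → x * aveIdem K N = x

theorem aveIdem_mul_of (K : Type*) [Field K] {G : Type*} [Group G] [Finite G] {N : Subgroup G}
    {n : G} (hn : n ∈ N) : aveIdem K N * MonoidAlgebra.of K G n = aveIdem K N := by
  have := Fintype.ofFinite N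
  simp only [aveIdem, finsum_eq_sum_of_fintype, smul_mul_assoc, Finset.sum_mul, ← map_mul]
  congr 1
  exact Fintype.sum_equiv (Equiv.mulRight (⟨n, hn⟩ : N)) _ _ fun _ => rfl

theorem mul_aveIdem_of_forall_mul_of (K : Type*) [Field K] [CharZero K] {G : Type*} [Group G]
    [Finite G] {N : Subgroup G} {x : MonoidAlgebra K G}
    (hx : ∀ n ∈ N, x * MonoidAlgebra.of K G n = x) : x * aveIdem K N = x := by
  have := Fintype.ofFinite N
  have hcard : (Nat.card N : K) ≠ 0 := Nat.cast_ne_zero.mpr Nat.card_pos.ne'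
  have hsum : ∑ n : N, x * MonoidAlgebra.of K G (n : G) = ∑ _n : N, x :=
    Finset.sum_congr rfl fun n _ => hx n n.2
  rw [aveIdem, finsum_eq_sum_of_fintype, mul_smul_comm, Finset.mul_sum, hsum, Finset.sum_const,
    Finset.card_univ, ← Nat.card_eq_fintype_card, ← Nat.cast_smul_eq_nsmul K, smul_smul,
    inv_mul_cancel₀ hcard, one_smul]

/-- The elements of `G` that fix every nilpotent element of `K[G]` under right multiplication. -/
def nilpotentFixer (K : Type*) [Field K] (G : Type*) [Group G] : Subgroup G where
  carrier := {g | ∀ x : MonoidAlgebra K G, IsNilpotent x → x * MonoidAlgebra.of K G g = x}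
  one_mem' x _ := by rw [map_one, mul_one]
  mul_mem' {a b} ha hb x hx := by rw [map_mul, ← mul_assoc, ha x hx, hb x hx]
  inv_mem' {a} ha x hx := by
    conv_lhs => rw [← ha x hx]
    rw [mul_assoc, ← map_mul, mul_inv_cancel, map_one, mul_one]

theorem isNilpotent_of_inv_mul_mul_of {K : Type*} [Field K] {G : Type*} [Group G] (g : G)
    {x : MonoidAlgebra K G} (hx : IsNilpotent x) :
    IsNilpotent (MonoidAlgebra.of K G g⁻¹ * x * MonoidAlgebra.of K G g) := by
  obtain ⟨k, hk⟩ := hx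
  let u : (MonoidAlgebra K G)ˣ := Units.map (MonoidAlgebra.of K G) (toUnits g)
  have hu := u.conj_pow' x k
  exact ⟨k, by rw [hk, mul_zero, zero_mul] at hu; exact hu⟩

theorem nilpotentFixer_normal (K : Type*) [Field K] (G : Type*) [Group G] :
    (nilpotentFixer K G).Normal where
  conj_mem n hn g x hx := by
    have h := hn _ (isNilpotent_of_inv_mul_mul_of g hx)
    have h' := congrArg (fun y => MonoidAlgebra.of K G g * y * MonoidAlgebra.of K G g⁻¹) h
    have hg : MonoidAlgebra.of K G g * MonoidAlgebra.of K G g⁻¹ = 1 := by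
      rw [← map_mul, mul_inv_cancel, map_one]
    simp only [← mul_assoc, hg, one_mul] at h'
    rw [mul_assoc x (MonoidAlgebra.of K G g) (MonoidAlgebra.of K G g⁻¹), hg, mul_one] at h'
    rw [map_mul, map_mul, ← mul_assoc, ← mul_assoc, h']

theorem stmt0 (K : Type*) [Field K] [CharZero K] (G : Type*) [Group G] [Finite G] :
    ∃ N₀ : Subgroup G, N₀.Normal ∧ IsNKW K N₀ ∧
      ∀ N : Subgroup G, N.Normal → IsNKW K N → N ≤ N₀ := by
  refine ⟨nilpotentFixer K G, nilpotentFixer_normal K G,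
    fun x hx => mul_aveIdem_of_forall_mul_of K fun n hn => hn x hx, fun N _ hN n hn x hx => ?_⟩
  rw [← hN x hx, mul_assoc, aveIdem_mul_of K hn]
end

section
/- Let K be a field of characteristic zero, G a finite group, and N a normal subgroup of G that is a nonideal-kernel witness over K. Then every subgroup U of G with N ⊄ U is normal in G. In particular, N is contained in every nonnormal subgroup of G, i.e. N ≤ R(G), where R(G) denotes the intersection of all nonnormal subgroups of G. -/
open scoped BigOperators

/-- The sum of the elements of a subgroup in the group algebra is fixed by right multiplication
by elements of the subgroup. -/
lemma finsum_of_mul_of (K : Type*) [Field K] {G : Type*} [Group G] [Finite G] (U : Subgroup G)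
    {u : G} (hu : u ∈ U) :
    (∑ᶠ a : U, MonoidAlgebra.of K G (a : G)) * MonoidAlgebra.of K G u =
      ∑ᶠ a : U, MonoidAlgebra.of K G (a : G) := by
  rw [finsum_mul' _ _ (Set.toFinite _)]
  conv_rhs => rw [← finsum_comp_equiv (Equiv.mulRight (⟨u, hu⟩ : U))]
  simp only [Equiv.coe_mulRight, Subgroup.coe_mul, map_mul]

open Classical in
/-- The coefficients of the sum of the elements of a subgroup. -/
lemma finsum_of_apply (K : Type*) [Field K] {G : Type*} [Group G] [Finite G] (U : Subgroup G)
    (g : G) :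
    (∑ᶠ a : U, MonoidAlgebra.of K G (a : G)).coeff g = if g ∈ U then 1 else 0 := by
  have := Fintype.ofFinite U
  rw [finsum_eq_sum_of_fintype]
  simp only [MonoidAlgebra.of_apply, MonoidAlgebra.coeff_sum, Finsupp.finsetSum_apply,
    MonoidAlgebra.coeff_single, Finsupp.single_apply]
  split_ifs with h
  · rw [Finset.sum_eq_single ⟨g, h⟩] <;> simp [Subtype.ext_iff]
  · exact Finset.sum_eq_zero fun a _ => if_neg fun (e : (a : G) = g) => h (e ▸ a.2)

/-- Under the witness condition, nilpotent elements are fixed by right multiplication by `N`. -/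
lemma IsNKW.mul_of_eq {K : Type*} [Field K] {G : Type*} [Group G] [Finite G] {N : Subgroup G}
    (h : IsNKW K N) {x : MonoidAlgebra K G} (hx : IsNilpotent x) {n : G} (hn : n ∈ N) :
    x * MonoidAlgebra.of K G n = x := by
  have he : aveIdem K N * MonoidAlgebra.of K G n = aveIdem K N := by
    rw [aveIdem, smul_mul_assoc, finsum_of_mul_of K N hn]
  rw [← h x hx, mul_assoc, he]

/-- Under the witness condition, every subgroup not containing `N` is normal. -/
lemma IsNKW.normal_of_not_le {K : Type*} [Field K] [CharZero K] {G : Type*} [Group G] [Finite G]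
    {N : Subgroup G} (h : IsNKW K N) {U : Subgroup G} (hU : ¬ N ≤ U) : U.Normal := by
  obtain ⟨n, hnN, hnU⟩ := SetLike.not_le_iff_exists.mp hU
  refine ⟨fun u hu g => ?_⟩
  by_contra hg
  set s : MonoidAlgebra K G := ∑ᶠ a : U, MonoidAlgebra.of K G (a : G)
  have hsu : s * MonoidAlgebra.of K G u = s := finsum_of_mul_of K U hu
  classical
  have hcoeff : ∀ a, s.coeff a = if a ∈ U then 1 else 0 := finsum_of_apply K U
  clear_value s
  have hnil : IsNilpotent ((1 - MonoidAlgebra.of K G u) * MonoidAlgebra.of K G g⁻¹ * s) := by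
    refine ⟨2, ?_⟩
    have h0 : s * (1 - MonoidAlgebra.of K G u) = 0 := by rw [mul_sub, mul_one, hsu, sub_self]
    rw [sq]
    simp only [mul_assoc]
    rw [← mul_assoc s, h0]
    simp
  have hfix := congrArg (fun y : MonoidAlgebra K G => y.coeff (g⁻¹ * n)) (h.mul_of_eq hnil hnN)
  have hg' : g * u⁻¹ * g⁻¹ ∉ U := fun h' => hg (by simpa [mul_assoc] using U.inv_mem h')
  simp only [sub_mul, one_mul, MonoidAlgebra.of_apply, MonoidAlgebra.coeff_sub,
    Finsupp.sub_apply, MonoidAlgebra.coeff_mul_single_apply,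
    MonoidAlgebra.coeff_single_mul_apply, mul_one, hcoeff, mul_assoc, inv_inv,
    mul_inv_cancel_left, mul_inv_cancel, one_mem, hnU, if_true, if_false] at hfix
  rw [← mul_assoc g u⁻¹ g⁻¹, if_neg hg'] at hfix
  split_ifs at hfix <;> norm_num at hfix

theorem stmt7 (K : Type*) [Field K] [CharZero K] (G : Type*) [Group G] [Finite G]
    (N : Subgroup G) (hN : N.Normal) (hNKW : IsNKW K N) :
    (∀ U : Subgroup G, ¬ N ≤ U → U.Normal) ∧
    N ≤ ⨅ U ∈ {U : Subgroup G | ¬ U.Normal}, U := by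
  refine ⟨fun U hU => hNKW.normal_of_not_le hU, le_iInf₂ fun U hU => ?_⟩
  by_contra hle
  exact hU (hNKW.normal_of_not_le hle)
end

section
/- Let G be a finite group. Then: (a) the group algebra ℚ₂[G] over the field of 2-adic numbers is reduced if and only if ℚ[G] is reduced; (b) for every odd prime p, the group algebra ℚ_p[G] over the field of p-adic numbers is reduced if and only if G is abelian; (c) the group algebra ℝ[G] is reduced if and only if either G is abelian or G ≅ Q₈ × (C₂)^r for some r ≥ 0. -/
section

open MonoidAlgebra

theorem isReduced_of_mul_self {R : Type*} [Ring R] (h : ∀ x : R, x * x = 0 → x = 0) :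
    IsReduced R :=
  (isReduced_iff_pow_one_lt 2 one_lt_two).2 fun x hx => h x (by rwa [← sq])

theorem eq_zero_of_mul_self {R : Type*} [Ring R] [IsReduced R] {x : R} (h : x * x = 0) : x = 0 :=
  IsReduced.eq_zero x ⟨2, by rw [sq, h]⟩

/-- A quotient of a reduced semisimple ring is reduced. -/
theorem isReduced_of_surjective {R S : Type*} [Ring R] [Ring S] [IsSemisimpleRing R]
    [IsReduced R] (f : R →+* S) (hf : Function.Surjective f) : IsReduced S := by
  refine isReduced_of_mul_self fun b hb => ?_
  obtain ⟨β, rfl⟩ := hf b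
  obtain ⟨J, hJ⟩ := exists_isCompl (Ideal.span {β})
  have h1 : (1 : R) ∈ Ideal.span {β} ⊔ J := by rw [hJ.sup_eq_top]; trivial
  obtain ⟨u, hu, δ, hδ, huδ⟩ := Submodule.mem_sup.1 h1
  obtain ⟨γ, rfl⟩ := Ideal.mem_span_singleton'.1 hu
  have hβ : β = β * (γ * β) := by
    have h2 : β * δ = β - β * (γ * β) := by
      rw [eq_sub_of_add_eq' huδ]; noncomm_ring
    have h3 : β * δ ∈ Ideal.span {β} ⊓ J := by
      refine ⟨?_, J.mul_mem_left _ hδ⟩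
      rw [h2]
      exact sub_mem (Ideal.mem_span_singleton_self β)
        (Ideal.mul_mem_left _ _ (Ideal.mul_mem_left _ _ (Ideal.mem_span_singleton_self β)))
    rw [hJ.inf_eq_bot] at h3
    rw [(Submodule.mem_bot R).1 h3] at h2
    exact (sub_eq_zero.1 h2.symm)
  have he : (γ * β) * (γ * β) = γ * β := by
    rw [mul_assoc, ← hβ]
  have h4 : (1 - γ * β) * β * (γ * β) = 0 := by
    apply eq_zero_of_mul_self
    have : (γ * β) * (1 - γ * β) = 0 := by rw [mul_sub, he, mul_one, sub_self]
    calc _ = (1 - γ * β) * β * ((γ * β) * (1 - γ * β)) * (β * (γ * β)) := by noncomm_ring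
      _ = 0 := by rw [this]; simp
  have h5 : β = γ * (β * β) := by
    rw [mul_assoc, ← hβ] at h4
    rw [sub_mul, one_mul, sub_eq_zero, mul_assoc] at h4
    exact h4
  rw [h5, map_mul, map_mul, hb, mul_zero]

section

variable {K G H : Type*} [Field K] [Group G] [Group H]

theorem isReduced_of_injective_hom (f : H →* G) (hf : Function.Injective f)
    [IsReduced (MonoidAlgebra K G)] : IsReduced (MonoidAlgebra K H) :=
  isReduced_of_injective (MonoidAlgebra.mapDomainRingHom K f) (MonoidAlgebra.mapDomain_injective hf)

variable [CharZero K]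

theorem isReduced_of_surjective_hom [Finite H] (f : H →* G) (hf : Function.Surjective f)
    [IsReduced (MonoidAlgebra K H)] : IsReduced (MonoidAlgebra K G) := by
  have : NeZero (Nat.card H : K) := ⟨Nat.cast_ne_zero.2 Nat.card_pos.ne'⟩
  exact isReduced_of_surjective (MonoidAlgebra.mapDomainRingHom K f) <|
    fun x => x.induction_linear ⟨0, map_zero _⟩
      (fun _ _ ⟨u, hu⟩ ⟨v, hv⟩ => ⟨u + v, by rw [map_add, hu, hv]⟩)
      (fun g r => (hf g).elim fun h hh => ⟨single h r, by simp [hh]⟩)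

theorem isReduced_of_comm [Finite G] (h : ∀ a b : G, a * b = b * a) :
    IsReduced (MonoidAlgebra K G) := by
  let _ : CommGroup G := { (inferInstance : Group G) with mul_comm := h }
  have : NeZero (Nat.card G : K) := ⟨Nat.cast_ne_zero.2 Nat.card_pos.ne'⟩
  have : IsSemisimpleRing (MonoidAlgebra K G) := inferInstance
  infer_instance

theorem conj_mem_zpowers [Finite G] [IsReduced (MonoidAlgebra K G)] (g h : G) :
    g * h * g⁻¹ ∈ Subgroup.zpowers h := by
  classical
  have h0 : 0 < orderOf h := orderOf_pos h
  set s : MonoidAlgebra K G := ∑ i ∈ Finset.range (orderOf h), single (h ^ i) 1 with hs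
  have hs1 : single h 1 * s = s := by
    obtain ⟨n, hn⟩ : ∃ n, orderOf h = n + 1 := ⟨_, (Nat.succ_pred_eq_of_pos h0).symm⟩
    rw [hs, Finset.mul_sum]
    simp only [single_mul_single, mul_one, ← pow_succ']
    rw [hn, Finset.sum_range_succ, Finset.sum_range_succ', ← hn, pow_orderOf_eq_one, pow_zero]
  have key : s * single g 1 * (1 - single h 1) = 0 := by
    apply eq_zero_of_mul_self
    calc _ = s * single g 1 * ((1 - single h 1) * s) * single g 1 * (1 - single h 1) := by
          noncomm_ring
      _ = 0 := by rw [sub_mul, one_mul, hs1]; simp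
  rw [mul_sub, mul_one, sub_eq_zero] at key
  have hc := congrArg (fun t => t.coeff g) key
  simp only [hs, Finset.sum_mul, single_mul_single, mul_one, coeff_sum, Finset.sum_apply',
    coeff_single, Finsupp.single_apply, mul_eq_right, Finset.sum_boole] at hc
  have : 0 < ((Finset.range (orderOf h)).filter fun i => h ^ i = 1).card :=
    Finset.card_pos.2 ⟨0, by simp [h0]⟩
  have h2 := (Nat.cast_injective hc) ▸ this
  obtain ⟨i, hi⟩ := Finset.card_pos.1 h2
  rw [Finset.mem_filter] at hi
  have : g * h * g⁻¹ = (h ^ i)⁻¹ := by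
    rw [mul_inv_eq_iff_eq_mul, eq_inv_mul_iff_mul_eq, ← mul_assoc, hi.2]
  rw [this]
  exact inv_mem (pow_mem (Subgroup.mem_zpowers h) i)

end

/-- The form `a² + b² + c² + d²` represents zero only trivially. -/
def FourSquaresAnisotropic (R : Type*) [CommRing R] : Prop :=
  ∀ a b c d : R, a ^ 2 + b ^ 2 + c ^ 2 + d ^ 2 = 0 → a = 0

theorem FourSquaresAnisotropic.of_injective {R S : Type*} [CommRing R] [CommRing S]
    (hS : FourSquaresAnisotropic S) (f : R →+* S) (hf : Function.Injective f) :
    FourSquaresAnisotropic R := fun a b c d h =>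
  (injective_iff_map_eq_zero f).1 hf a
    (hS _ (f b) (f c) (f d) (by simpa using congrArg f h))

theorem FourSquaresAnisotropic.prod {R S : Type*} [CommRing R] [CommRing S]
    (hR : FourSquaresAnisotropic R) (hS : FourSquaresAnisotropic S) :
    FourSquaresAnisotropic (R × S) := fun a b c d h =>
  Prod.ext (hR a.1 b.1 c.1 d.1 (congrArg Prod.fst h)) (hS a.2 b.2 c.2 d.2 (congrArg Prod.snd h))

theorem FourSquaresAnisotropic.isReduced {R : Type*} [CommRing R]
    (hR : FourSquaresAnisotropic R) : IsReduced R :=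
  isReduced_of_mul_self fun x hx => hR x 0 0 0 (by linear_combination hx)

theorem FourSquaresAnisotropic.isReduced_quaternion {R : Type*} [CommRing R]
    (hR : FourSquaresAnisotropic R) : IsReduced (Quaternion R) := by
  have := hR.isReduced
  refine isReduced_of_mul_self fun x hx => ?_
  have h1 : Quaternion.normSq x = 0 := by
    apply eq_zero_of_mul_self
    rw [← map_mul, hx, map_zero]
  rw [Quaternion.normSq_def'] at h1
  ext
  · exact hR _ x.imI x.imJ x.imK h1
  · exact hR _ x.re x.imJ x.imK (by linear_combination h1)
  · exact hR _ x.re x.imI x.imK (by linear_combination h1)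
  · exact hR _ x.re x.imI x.imJ (by linear_combination h1)

theorem FourSquaresAnisotropic.eq_zero_of_add_self {R : Type*} [CommRing R]
    (hR : FourSquaresAnisotropic R) {x : R} (h : x + x = 0) : x = 0 :=
  hR x x 0 0 (by linear_combination x * h)

open QuaternionGroup in
/-- The homomorphism from the quaternion group determined by the images of its generators. -/
def quaternionLift {M : Type*} [Monoid M] (x y : M) (hx : x ^ 4 = 1) (hy : y ^ 2 = x ^ 2)
    (hxy : x * y = y * x ^ 3) : QuaternionGroup 2 →* M where
  toFun
    | a i => x ^ i.val
    | xa i => y * x ^ i.val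
  map_one' := by
    change x ^ (0 : ZMod 4).val = 1
    simp
  map_mul' := by
    have h1 : ∀ i j : ZMod 4, x ^ (i + j).val = x ^ i.val * x ^ j.val := fun i j => by
      rw [← pow_add, ZMod.val_add, ← pow_eq_pow_mod _ hx]
    have h2 : ∀ i : ZMod 4, x ^ i.val * y = y * x ^ (-i).val := fun i => by
      have h3 : ∀ n : ℕ, x ^ n * y = y * x ^ (3 * n) := fun n => by
        induction n with
        | zero => simp
        | succ n ih => rw [pow_succ, mul_assoc, hxy, ← mul_assoc, ih, mul_assoc, ← pow_add]; rfl
      rw [h3, pow_eq_pow_mod _ hx, pow_eq_pow_mod (-i).val hx]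
      congr 2
      revert i; decide
    rintro (i | i) (j | j)
    · exact h1 i j
    · change y * x ^ (j - i : ZMod 4).val = x ^ i.val * (y * x ^ j.val)
      rw [← mul_assoc, h2, mul_assoc, ← h1, sub_eq_neg_add]
    · change y * x ^ (i + j : ZMod 4).val = y * x ^ i.val * x ^ j.val
      rw [h1, mul_assoc]
    · change x ^ (2 + j - i : ZMod 4).val = y * x ^ i.val * (y * x ^ j.val)
      rw [mul_assoc, ← mul_assoc _ y, h2, mul_assoc, ← h1, ← mul_assoc, ← sq y, hy]
      exact (congrArg (fun k : ZMod 4 => x ^ k.val)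
        (show (2 + j - i : ZMod 4) = 2 + (-i + j) by ring)).trans (h1 2 _)

section
variable {M : Type*} [Monoid M] {x y : M} (hx : x ^ 4 = 1) (hy : y ^ 2 = x ^ 2)
    (hxy : x * y = y * x ^ 3)

theorem quaternionLift_a (i : ZMod 4) :
    quaternionLift x y hx hy hxy (.a i) = x ^ i.val := rfl

theorem quaternionLift_xa (i : ZMod 4) :
    quaternionLift x y hx hy hxy (.xa i) = y * x ^ i.val := rfl

end

theorem forall_zmod_four {p : ZMod 4 → Prop} : (∀ i, p i) ↔ p 0 ∧ p 1 ∧ p 2 ∧ p 3 :=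
  Fin.forall_fin_succ.trans (by simp [Fin.forall_fin_succ]; rfl)

theorem sum_quaternionGroup {M : Type*} [AddCommMonoid M] (f : QuaternionGroup 2 → M) :
    ∑ q, f q = f (.a 0) + f (.a 1) + f (.a 2) + f (.a 3) +
      (f (.xa 0) + f (.xa 1) + f (.xa 2) + f (.xa 3)) := by
  have : (Finset.univ : Finset (QuaternionGroup 2)) =
      {.a 0, .a 1, .a 2, .a 3, .xa 0, .xa 1, .xa 2, .xa 3} := by decide
  rw [this]
  repeat rw [Finset.sum_insert (by decide)]
  rw [Finset.sum_singleton]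
  simp only [add_assoc]

/-- The homomorphism from the quaternion group to the quaternions. -/
def quaternionHom (R : Type*) [CommRing R] :
    QuaternionGroup 2 →* QuaternionAlgebra R (-1) 0 (-1) :=
  quaternionLift ⟨0, 1, 0, 0⟩ ⟨0, 0, 1, 0⟩ (by ext <;> simp [pow_succ])
    (by ext <;> simp [pow_succ]) (by ext <;> simp [pow_succ])

theorem quaternionHom_a_one (R : Type*) [CommRing R] :
    quaternionHom R (.a 1) = ⟨0, 1, 0, 0⟩ := pow_one _

theorem quaternionHom_xa_zero (R : Type*) [CommRing R] :
    quaternionHom R (.xa 0) = ⟨0, 0, 1, 0⟩ := mul_one _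

theorem FourSquaresAnisotropic.isReduced_quaternionGroup {R : Type*} [CommRing R]
    (hR : FourSquaresAnisotropic R) : IsReduced (MonoidAlgebra R (QuaternionGroup 2)) := by
  have := hR.isReduced
  have := hR.isReduced_quaternion
  have : IsReduced (QuaternionAlgebra R (-1) 0 (-1)) := hR.isReduced_quaternion
  let F : MonoidAlgebra R (QuaternionGroup 2) →ₐ[R] QuaternionAlgebra R (-1) 0 (-1) :=
    MonoidAlgebra.lift R _ _ (quaternionHom R)
  let χ (s t : R) (hs : s ^ 2 = 1) (ht : t ^ 2 = 1) :
      MonoidAlgebra R (QuaternionGroup 2) →ₐ[R] R :=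
    MonoidAlgebra.lift R _ _ (quaternionLift s t (by linear_combination (s ^ 2 + 1) * hs)
      (by rw [hs, ht]) (by linear_combination -s * t * hs))
  refine isReduced_of_mul_self fun x hx => ?_
  have hF : F x = 0 := eq_zero_of_mul_self (by rw [← map_mul, hx, map_zero])
  have hχ (s t : R) (hs : s ^ 2 = 1) (ht : t ^ 2 = 1) : χ s t hs ht x = 0 :=
    eq_zero_of_mul_self (by rw [← map_mul, hx, map_zero])
  have e1 := hχ 1 1 (by ring) (by ring)
  have e2 := hχ 1 (-1) (by ring) (by ring)
  have e3 := hχ (-1) 1 (by ring) (by ring)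
  have e4 := hχ (-1) (-1) (by ring) (by ring)
  simp only [χ, F, MonoidAlgebra.lift_apply, Finsupp.sum_fintype, zero_smul, implies_true,
    sum_quaternionGroup, quaternionLift_a, quaternionLift_xa,
    quaternionHom] at e1 e2 e3 e4 hF
  have v0 : (0 : ZMod 4).val = 0 := rfl
  have v1 : (1 : ZMod 4).val = 1 := rfl
  have v2 : (2 : ZMod 4).val = 2 := rfl
  have v3 : (3 : ZMod 4).val = 3 := rfl
  simp only [v0, v1, v2, v3] at e1 e2 e3 e4 hF
  have f1 := congrArg QuaternionAlgebra.re hF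
  have f2 := congrArg QuaternionAlgebra.imI hF
  have f3 := congrArg QuaternionAlgebra.imJ hF
  have f4 := congrArg QuaternionAlgebra.imK hF
  simp [pow_succ] at e1 e2 e3 e4 f1 f2 f3 f4
  have h8 (r : R) (h : 8 * r = 0) : r = 0 := by
    iterate 3 apply hR.eq_zero_of_add_self
    linear_combination h
  ext q
  rcases q with i | i <;> revert i
  · refine forall_zmod_four.2 ⟨?_, ?_, ?_, ?_⟩ <;> apply h8
    · change 8 * x.coeff 1 = 0
      linear_combination e1 + e2 + e3 + e4 + 4 * f1
    · linear_combination e1 + e2 - e3 - e4 + 4 * f2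
    · linear_combination e1 + e2 + e3 + e4 - 4 * f1
    · linear_combination e1 + e2 - e3 - e4 - 4 * f2
  · refine forall_zmod_four.2 ⟨?_, ?_, ?_, ?_⟩ <;> apply h8
    · linear_combination e1 - e2 + e3 - e4 + 4 * f3
    · linear_combination e1 - e2 - e3 + e4 - 4 * f4
    · linear_combination e1 - e2 + e3 - e4 - 4 * f3
    · linear_combination e1 - e2 - e3 + e4 + 4 * f4

theorem FourSquaresAnisotropic.monoidAlgebra_zmod_two {R : Type*} [CommRing R]
    (hR : FourSquaresAnisotropic R) :
    FourSquaresAnisotropic (MonoidAlgebra R (Multiplicative (ZMod 2))) := by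
  let χ : Multiplicative (ZMod 2) →* R :=
    { toFun := fun g => if g = 1 then 1 else -1
      map_one' := if_pos rfl
      map_mul' := by
        have h : ∀ g : Multiplicative (ZMod 2), g = 1 ∨ g = .ofAdd 1 := by decide
        have h2 : Multiplicative.ofAdd (1 : ZMod 2) ≠ 1 := by decide
        have h3 : Multiplicative.ofAdd (1 : ZMod 2) * .ofAdd 1 = 1 := by decide
        intro g g'
        rcases h g with rfl | rfl <;> rcases h g' with rfl | rfl <;> simp [h2, h3] }
  refine (hR.prod hR).of_injective (RingHom.prod
    (MonoidAlgebra.lift R R (Multiplicative (ZMod 2)) 1).toRingHom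
    (MonoidAlgebra.lift R R (Multiplicative (ZMod 2)) χ).toRingHom) ?_
  rw [injective_iff_map_eq_zero]
  intro x hx
  have e1 := congrArg Prod.fst hx
  have e2 := congrArg Prod.snd hx
  have hu : (Finset.univ : Finset (Multiplicative (ZMod 2))) = {1, .ofAdd 1} := by decide
  have h2 : (1 : Multiplicative (ZMod 2)) ≠ Multiplicative.ofAdd (1 : ZMod 2) := by decide
  simp [MonoidAlgebra.lift_apply, Finsupp.sum_fintype, hu, Finset.sum_pair h2, χ, h2.symm] at e1 e2
  ext g
  rcases (by decide : ∀ g : Multiplicative (ZMod 2), g = 1 ∨ g = .ofAdd 1) g with rfl | rfl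
  · exact hR.eq_zero_of_add_self (by linear_combination e1 + e2)
  · exact hR.eq_zero_of_add_self (by linear_combination e1 - e2)

theorem FourSquaresAnisotropic.monoidAlgebra_prod {R : Type*} [CommRing R] {M N : Type*}
    [CommMonoid M] [CommMonoid N] (h : FourSquaresAnisotropic (MonoidAlgebra (MonoidAlgebra R N) M)) :
    FourSquaresAnisotropic (MonoidAlgebra R (M × N)) :=
  h.of_injective (curryRingEquiv : _ ≃+* MonoidAlgebra (MonoidAlgebra R N) M).toRingHom
    curryRingEquiv.injective

theorem FourSquaresAnisotropic.monoidAlgebra_pi {R : Type*} [CommRing R]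
    (hR : FourSquaresAnisotropic R) (r : ℕ) :
    FourSquaresAnisotropic (MonoidAlgebra R (Fin r → Multiplicative (ZMod 2))) := by
  induction r with
  | zero =>
    let e : MonoidAlgebra R (Fin 0 → Multiplicative (ZMod 2)) ≃+* R := uniqueRingEquiv _
    exact hR.of_injective e.toRingHom e.injective
  | succ r ih =>
    let f : (Fin (r + 1) → Multiplicative (ZMod 2)) →*
        Multiplicative (ZMod 2) × (Fin r → Multiplicative (ZMod 2)) :=
      { toFun := fun g => (g 0, fun i => g i.succ)
        map_one' := rfl
        map_mul' := fun _ _ => rfl }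
    refine (monoidAlgebra_prod ih.monoidAlgebra_zmod_two).of_injective (mapDomainRingHom R f)
      (mapDomain_injective fun g g' h => funext fun i => ?_)
    refine Fin.cases (congrArg Prod.fst h) (fun i => congrFun (congrArg Prod.snd h) i) i

theorem exists_mulEquiv_pi_zmod_two {E : Type*} [CommGroup E] [Finite E] (hE : ∀ g : E, g ^ 2 = 1) :
    ∃ r : ℕ, Nonempty (E ≃* (Fin r → Multiplicative (ZMod 2))) := by
  let _ : Module (ZMod 2) (Additive E) := AddCommGroup.zmodModule (n := 2) fun x => hE x.toMul
  let b := Module.finBasis (ZMod 2) (Additive E)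
  exact ⟨_, ⟨{ toFun := fun g i => .ofAdd (b.equivFun (.ofMul g) i)
               invFun := fun v => (b.equivFun.symm fun i => (v i).toAdd).toMul
               left_inv := fun g => by simp
               right_inv := fun v => by ext i; simp [-Module.Basis.equivFun_apply]
               map_mul' := fun g g' => by ext i; simp }⟩⟩

theorem FourSquaresAnisotropic.monoidAlgebra_of_sq_eq_one {R : Type*} [CommRing R]
    (hR : FourSquaresAnisotropic R) {E : Type*} [CommGroup E] [Finite E]
    (hE : ∀ g : E, g ^ 2 = 1) : FourSquaresAnisotropic (MonoidAlgebra R E) := by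
  obtain ⟨r, ⟨e⟩⟩ := exists_mulEquiv_pi_zmod_two hE
  exact (hR.monoidAlgebra_pi r).of_injective (mapDomainRingHom R e.toMonoidHom)
    (mapDomain_injective e.injective)

theorem FourSquaresAnisotropic.isReduced_quaternionGroup_prod {R : Type*} [CommRing R] {N : Type*}
    [CommMonoid N] (h : FourSquaresAnisotropic (MonoidAlgebra R N)) :
    IsReduced (MonoidAlgebra R (QuaternionGroup 2 × N)) :=
  have := h.isReduced_quaternionGroup
  isReduced_of_injective
    (curryRingEquiv : _ ≃+* MonoidAlgebra (MonoidAlgebra R N) (QuaternionGroup 2))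
    curryRingEquiv.injective

theorem fourSquaresAnisotropic_real : FourSquaresAnisotropic ℝ := fun a b c d h => by
  have : a ^ 2 = 0 := by nlinarith [sq_nonneg a, sq_nonneg b, sq_nonneg c, sq_nonneg d]
  exact pow_eq_zero_iff two_ne_zero |>.1 this

/-- If `-1` is a sum of two squares in a commutative algebra generated by a character of `N`, then
the group algebra of `Q₈ × N` is not reduced. -/
theorem sq_add_sq_add_one_ne_zero {K B N : Type*} [Field K] [CharZero K] [CommRing B] [Nontrivial B]
    [Algebra K B] [Group N] [Finite N] (hred : IsReduced (MonoidAlgebra K (QuaternionGroup 2 × N)))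
    (χ : N →* B) {a b : B} (ha : a ∈ Algebra.adjoin K (Set.range χ))
    (hb : b ∈ Algebra.adjoin K (Set.range χ)) : a ^ 2 + b ^ 2 + 1 ≠ 0 := by
  intro h0
  have hcomm : ∀ (b : B) (q : QuaternionAlgebra B (-1) 0 (-1)),
      Commute (algebraMap B (QuaternionAlgebra B (-1) 0 (-1)) b) q := Algebra.commutes
  let φ : QuaternionGroup 2 × N →* QuaternionAlgebra B (-1) 0 (-1) :=
    { toFun := fun g => quaternionHom B g.1 * algebraMap B (QuaternionAlgebra B (-1) 0 (-1)) (χ g.2)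
      map_one' := by simp
      map_mul' := fun g g' => by
        rw [Prod.fst_mul, Prod.snd_mul, map_mul, map_mul, map_mul, mul_assoc, mul_assoc,
          ← mul_assoc (algebraMap B (QuaternionAlgebra B (-1) 0 (-1)) _) (quaternionHom B _),
          (hcomm _ (quaternionHom B g'.1)).eq, mul_assoc] }
  let F : MonoidAlgebra K (QuaternionGroup 2 × N) →ₐ[K] QuaternionAlgebra B (-1) 0 (-1) :=
    MonoidAlgebra.lift K _ _ φ
  have : NeZero (Nat.card (QuaternionGroup 2 × N) : K) := ⟨Nat.cast_ne_zero.2 Nat.card_pos.ne'⟩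
  have hred' : IsReduced F.range :=
    isReduced_of_surjective F.rangeRestrict.toRingHom F.rangeRestrict_surjective
  have hφ : ∀ g, φ g ∈ F.range := fun g => ⟨single g 1, by simp [F]⟩
  have hmem : ∀ c ∈ Algebra.adjoin K (Set.range χ),
      algebraMap B (QuaternionAlgebra B (-1) 0 (-1)) c ∈ F.range := by
    have : Algebra.adjoin K (Set.range χ) ≤ F.range.comap
        (IsScalarTower.toAlgHom K B (QuaternionAlgebra B (-1) 0 (-1))) := by
      refine Algebra.adjoin_le ?_
      rintro _ ⟨n, rfl⟩
      have := hφ (1, n)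
      simpa [φ] using this
    exact fun c hc => this hc
  have hi : (⟨0, 1, 0, 0⟩ : QuaternionAlgebra B (-1) 0 (-1)) ∈ F.range := by
    have := hφ (.a 1, 1)
    simpa [φ, quaternionHom_a_one] using this
  have hj : (⟨0, 0, 1, 0⟩ : QuaternionAlgebra B (-1) 0 (-1)) ∈ F.range := by
    have := hφ (.xa 0, 1)
    simpa [φ, quaternionHom_xa_zero] using this
  have hz : (⟨0, a, b, 1⟩ : QuaternionAlgebra B (-1) 0 (-1)) ∈ F.range := by
    convert add_mem (add_mem (mul_mem (hmem a ha) hi) (mul_mem (hmem b hb) hj)) (mul_mem hi hj)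
      using 1
    ext <;> simp
  have hsq : (⟨⟨0, a, b, 1⟩, hz⟩ : F.range) * ⟨⟨0, a, b, 1⟩, hz⟩ = 0 := by
    ext <;> simp
    · linear_combination -h0
    all_goals ring
  have := congrArg QuaternionAlgebra.imK (congrArg Subtype.val (eq_zero_of_mul_self hsq))
  exact one_ne_zero this

section
variable {R : Type*} [CommRing R] {k : ℕ} (hk : Odd k) (hR : ∀ x : R, 2 ∣ x ^ 2 ^ k - x)
include hR

theorem two_dvd_of_two_dvd_sq (hk : Odd k) {x : R} (hx : 2 ∣ x ^ 2) : 2 ∣ x := by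
  have h2 : 2 ∣ x ^ 2 ^ k := hx.trans (pow_dvd_pow x
    (Nat.le_of_dvd (by positivity) (dvd_pow_self 2 hk.pos.ne')))
  exact (dvd_sub_right h2).1 (hR x)

theorem two_dvd_of_two_dvd_sq_add_mul_add_sq (hk : Odd k) {u v : R}
    (h : 2 ∣ u ^ 2 + u * v + v ^ 2) : 2 ∣ u := by
  obtain ⟨t, ht⟩ : ∃ t, 2 ^ k = 3 * t + 2 := by
    have : 2 ^ k % 3 = 2 := by
      obtain ⟨m, rfl⟩ := hk
      rw [pow_succ, pow_mul, Nat.mul_mod, Nat.pow_mod]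
      norm_num
    exact ⟨2 ^ k / 3, by omega⟩
  have hu := hR u
  have hv := hR v
  rw [ht, pow_add, pow_mul] at hu hv
  have h3 : 2 ∣ u ^ 3 - v ^ 3 := by
    rw [show u ^ 3 - v ^ 3 = (u - v) * (u ^ 2 + u * v + v ^ 2) by ring]
    exact h.mul_left _
  have h3t : 2 ∣ (u ^ 3) ^ t - (v ^ 3) ^ t := h3.trans (sub_dvd_pow_sub_pow _ _ t)
  apply two_dvd_of_two_dvd_sq hR hk
  obtain ⟨α, hα⟩ := hu
  obtain ⟨β, hβ⟩ := hv
  obtain ⟨γ, hγ⟩ := h3t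
  obtain ⟨δ, hδ⟩ := h
  exact ⟨u * (u ^ 3) ^ t * δ - u * α - v * α - u * β - u * γ * v ^ 2 - u * v, by
    linear_combination (u * (u ^ 3) ^ t) * hδ - (u + v) * hα - u * hβ - u * v ^ 2 * hγ⟩

theorem two_dvd_of_four_squares_eq_zero (hk : Odd k) (h2 : ∀ x : R, 2 * x = 0 → x = 0)
    {a b c d : R} (h : a ^ 2 + b ^ 2 + c ^ 2 + d ^ 2 = 0) : 2 ∣ a ∧ 2 ∣ b ∧ 2 ∣ c ∧ 2 ∣ d := by
  obtain ⟨e, he⟩ : 2 ∣ a + b + c + d := two_dvd_of_two_dvd_sq hR hk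
    ⟨a * b + a * c + a * d + b * c + b * d + c * d, by linear_combination h⟩
  obtain rfl : d = 2 * e - (a + b + c) := by linear_combination he
  have hQ := h2 (a ^ 2 + b ^ 2 + c ^ 2 + a * b + b * c + c * a + 2 * e ^ 2 - 2 * e * (a + b + c))
    (by linear_combination h)
  obtain ⟨p, hp⟩ : 2 ∣ a + c := two_dvd_of_two_dvd_sq_add_mul_add_sq hR hk (v := b + c)
    ⟨c ^ 2 + a * c + b * c + e * (a + b + c) - e ^ 2, by linear_combination hQ⟩
  obtain ⟨q, hq⟩ : 2 ∣ b + c := two_dvd_of_two_dvd_sq_add_mul_add_sq hR hk (v := a + c)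
    ⟨c ^ 2 + a * c + b * c + e * (a + b + c) - e ^ 2, by linear_combination hQ⟩
  obtain rfl : a = 2 * p - c := by linear_combination hp
  obtain rfl : b = 2 * q - c := by linear_combination hq
  have hc : 2 ∣ c := by
    have h4 := h2 _ (h2 (2 * (c ^ 2 + c * (e - p - q - p - q) + p ^ 2 + q ^ 2 + (e - p - q) ^ 2))
      (by linear_combination h))
    refine two_dvd_of_two_dvd_sq_add_mul_add_sq hR hk (v := e - p - q - p - q)
      ⟨p * q - (e - p - q) * (p + q), by linear_combination h4⟩
  obtain ⟨c, rfl⟩ := hc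
  exact ⟨⟨p - c, by ring⟩, ⟨q - c, by ring⟩, ⟨c, rfl⟩, ⟨e - p - q + c, by ring⟩⟩

theorem two_pow_dvd_of_four_squares_eq_zero (hk : Odd k) (h2 : ∀ x : R, 2 * x = 0 → x = 0)
    (n : ℕ) : ∀ {a b c d : R}, a ^ 2 + b ^ 2 + c ^ 2 + d ^ 2 = 0 → 2 ^ n ∣ a := by
  induction n with
  | zero => simp
  | succ n ih =>
    intro a b c d h
    obtain ⟨⟨a, rfl⟩, ⟨b, rfl⟩, ⟨c, rfl⟩, ⟨d, rfl⟩⟩ := two_dvd_of_four_squares_eq_zero hR hk h2 h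
    rw [pow_succ']
    exact mul_dvd_mul_left 2 (ih (h2 _ (h2 (2 * (a ^ 2 + b ^ 2 + c ^ 2 + d ^ 2))
      (by linear_combination h))))

end

theorem PadicInt.two_dvd_pow_sub_self {N : ℕ} (hN : N ≠ 0) (r : ℤ_[2]) : 2 ∣ r ^ N - r := by
  obtain ⟨n, hn, hr⟩ := PadicInt.exists_mem_range r
  rw [PadicInt.maximalIdeal_eq_span_p, Ideal.mem_span_singleton, Nat.cast_ofNat] at hr
  have h1 : (2 : ℤ_[2]) ∣ r ^ N - n ^ N := hr.trans (sub_dvd_pow_sub_pow _ _ N)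
  have h2 : (n : ℤ_[2]) ^ N = n := by
    interval_cases n <;> simp [hN]
  rw [h2] at h1
  convert dvd_sub h1 hr using 1
  ring

theorem MonoidAlgebra.two_pow_mul {R A : Type*} [CommRing R] [Monoid A] (n : ℕ)
    (x : MonoidAlgebra R A) : 2 ^ n * x = (2 : R) ^ n • x := by
  rw [Algebra.smul_def, map_pow, map_ofNat]

theorem two_dvd_pow_two_pow_sub_self {A : Type*} [CommGroup A] {k : ℕ}
    (hA : ∀ g : A, g ^ 2 ^ k = g) (x : MonoidAlgebra ℤ_[2] A) : 2 ∣ x ^ 2 ^ k - x := by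
  induction x using MonoidAlgebra.induction_linear with
  | zero => simp
  | add x y hx hy =>
    obtain ⟨r, hr⟩ := exists_add_pow_prime_pow_eq Nat.prime_two x y k
    have h3 : (2 : MonoidAlgebra ℤ_[2] A) ∣ 2 * (x * y * r) := dvd_mul_right _ _
    convert dvd_add (dvd_add hx hy) h3 using 1
    rw [hr]
    push_cast
    ring
  | single g r =>
    obtain ⟨s, hs⟩ := PadicInt.two_dvd_pow_sub_self (N := 2 ^ k) (by positivity) r
    refine ⟨single g s, ?_⟩
    have h2 := MonoidAlgebra.two_pow_mul 1 (single g s)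
    rw [pow_one, pow_one] at h2
    rw [h2, single_pow, hA, ← single_sub, hs, smul_single, smul_eq_mul]

theorem fourSquaresAnisotropic_padicInt {A : Type*} [CommGroup A] {k : ℕ} (hk : Odd k)
    (hA : ∀ g : A, g ^ 2 ^ k = g) : FourSquaresAnisotropic (MonoidAlgebra ℤ_[2] A) := by
  intro a b c d h
  have hdvd (n : ℕ) := two_pow_dvd_of_four_squares_eq_zero (two_dvd_pow_two_pow_sub_self hA) hk
    (fun x hx => by
      have h2 := MonoidAlgebra.two_pow_mul 1 x
      rw [pow_one, pow_one, hx] at h2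
      exact (smul_eq_zero.1 h2.symm).resolve_left two_ne_zero) n h
  ext g
  by_contra h0
  rw [coeff_zero, Finsupp.zero_apply] at h0
  obtain ⟨y, hy⟩ := hdvd ((a.coeff g).valuation + 1)
  have h1 := (PadicInt.mem_span_pow_iff_le_valuation (p := 2) (a.coeff g) h0
    ((a.coeff g).valuation + 1)).1 (Ideal.mem_span_singleton.2 ⟨y.coeff g, by
      conv_lhs => rw [hy, two_pow_mul]
      simp⟩)
  omega

theorem Padic.exists_two_pow_mul (r : ℚ_[2]) : ∃ n : ℕ, ∃ s : ℤ_[2], (s : ℚ_[2]) = 2 ^ n * r := by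
  obtain ⟨n, hn⟩ := pow_unbounded_of_one_lt ‖r‖ one_lt_two
  refine ⟨n, ⟨2 ^ n * r, ?_⟩, rfl⟩
  have h2 : ‖(2 : ℚ_[2])‖ = 2⁻¹ := by simpa using Padic.norm_p (p := 2)
  rw [norm_mul, norm_pow, h2, inv_pow, inv_mul_le_one₀ (by positivity)]
  exact hn.le

theorem fourSquaresAnisotropic_padic {A : Type*} [CommGroup A] {k : ℕ} (hk : Odd k)
    (hA : ∀ g : A, g ^ 2 ^ k = g) : FourSquaresAnisotropic (MonoidAlgebra ℚ_[2] A) := by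
  intro a b c d h
  let ι := mapRingHom A (algebraMap ℤ_[2] ℚ_[2])
  have hι : Function.Injective ι := map_injective _ (IsFractionRing.injective ℤ_[2] ℚ_[2])
  have hden (x : MonoidAlgebra ℚ_[2] A) : ∃ n : ℕ, ∃ y, ι y = 2 ^ n * x := by
    induction x using MonoidAlgebra.induction_linear with
    | zero => exact ⟨0, 0, by simp⟩
    | add x y hx hy =>
      obtain ⟨n, x', hx⟩ := hx
      obtain ⟨m, y', hy⟩ := hy
      refine ⟨n + m, 2 ^ m * x' + 2 ^ n * y', ?_⟩
      simp only [map_add, map_mul, map_pow, map_ofNat, hx, hy]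
      ring
    | single g r =>
      obtain ⟨n, s, hs⟩ := Padic.exists_two_pow_mul r
      refine ⟨n, single g s, ?_⟩
      rw [two_pow_mul, smul_single, smul_eq_mul, ← hs]
      simp [ι]
  obtain ⟨n₁, a', ha⟩ := hden a
  obtain ⟨n₂, b', hb⟩ := hden b
  obtain ⟨n₃, c', hc⟩ := hden c
  obtain ⟨n₄, d', hd⟩ := hden d
  have h1 : 2 ^ (n₂ + n₃ + n₄) * a' = 0 := by
    apply fourSquaresAnisotropic_padicInt hk hA _ (2 ^ (n₁ + n₃ + n₄) * b')
      (2 ^ (n₁ + n₂ + n₄) * c') (2 ^ (n₁ + n₂ + n₃) * d')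
    apply hι
    simp only [map_add, map_mul, map_pow, map_ofNat, ha, hb, hc, hd, map_zero]
    linear_combination (2 ^ (n₁ + n₂ + n₃ + n₄)) ^ 2 * h
  have h2 := congrArg ι h1
  simp only [map_mul, map_pow, map_ofNat, ha, map_zero, ← mul_assoc, ← pow_add] at h2
  have h3 (n : ℕ) (hn : (2 : MonoidAlgebra ℚ_[2] A) ^ n * a = 0) : a = 0 := by
    rw [two_pow_mul] at hn
    exact (smul_eq_zero.1 hn).resolve_left (pow_ne_zero _ two_ne_zero)
  exact h3 _ h2

theorem exists_odd_dvd_two_pow_sub_one (n : ℕ) : n ≠ 0 →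
    (∀ q : ℕ, q.Prime → q ∣ n → Odd (orderOf (2 : ZMod q))) →
    ∃ k, Odd k ∧ (n : ℤ) ∣ 2 ^ k - 1 := by
  induction n using induction_on_primes with
  | zero => exact fun h => absurd rfl h
  | one => exact fun _ _ => ⟨1, odd_one, by simp⟩
  | prime_mul p a hp ih =>
    intro h0 h
    obtain ⟨k, hk, hak⟩ := ih (right_ne_zero_of_mul h0) fun q hq hqa => h q hq (hqa.mul_left p)
    have hop := h p hp (dvd_mul_right p a)
    have hodd : Odd p := by
      rcases hp.eq_two_or_odd' with rfl | h2
      · have : orderOf (2 : ZMod 2) = 0 := by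
          rw [show (2 : ZMod 2) = 0 from rfl]
          exact orderOf_zero _
        rw [this] at hop
        exact absurd hop (by decide)
      · exact h2
    refine ⟨k * orderOf (2 : ZMod p) * p, (hk.mul hop).mul hodd, ?_⟩
    have ha : (a : ℤ) ∣ 2 ^ (k * orderOf (2 : ZMod p)) - 1 := by
      rw [pow_mul]
      exact hak.trans (by simpa using sub_dvd_pow_sub_pow ((2 : ℤ) ^ k) 1 (orderOf (2 : ZMod p)))
    have hp1 : ((2 ^ (k * orderOf (2 : ZMod p)) : ℤ) : ZMod p) = 1 := by
      push_cast
      rw [mul_comm, pow_mul, pow_orderOf_eq_one, one_pow]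
    have hsum : (p : ℤ) ∣ ∑ i ∈ Finset.range p, (2 ^ (k * orderOf (2 : ZMod p)) : ℤ) ^ i := by
      rw [← ZMod.intCast_zmod_eq_zero_iff_dvd, Int.cast_sum]
      push_cast at hp1
      simp [hp1]
    rw [pow_mul, ← geom_sum_mul, Nat.cast_mul]
    exact mul_dvd_mul hsum ha

theorem pow_two_pow_eq_self {A : Type*} [Group A] {n k : ℕ} (h : (n : ℤ) ∣ 2 ^ k - 1) {g : A}
    (hg : g ^ n = 1) : g ^ 2 ^ k = g := by
  obtain ⟨c, hc⟩ := h
  have : g ^ ((2 : ℤ) ^ k - 1) = 1 := by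
    rw [hc, zpow_mul, zpow_natCast, hg, one_zpow]
  rw [zpow_sub_one, mul_inv_eq_one] at this
  exact_mod_cast this

theorem exists_sq_add_sq_mul_one_sub {S : Type*} [CommRing S] (η : S) (m : ℕ) :
    ∃ u v : S, (1 - η ^ 2) * (u ^ 2 + v ^ 2) = 1 - (η ^ 2) ^ 2 ^ m := by
  induction m with
  | zero => exact ⟨1, 0, by ring⟩
  | succ m ih =>
    obtain ⟨u, v, h⟩ := ih
    refine ⟨u - v * η ^ 2 ^ m, u * η ^ 2 ^ m + v, ?_⟩
    linear_combination (1 + (η ^ 2 ^ m) ^ 2) * h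

theorem exists_sq_add_sq_add_one_eq_zero_of_rootOfUnity {S : Type*} [CommRing S] [IsDomain S]
    {q m : ℕ} (hq : Odd q) (hm : q ∣ 2 ^ m + 1) {ζ : S} (h1 : ζ ≠ 1) (hζ : ζ ^ q = 1) :
    ∃ a b : S, a ^ 2 + b ^ 2 + 1 = 0 := by
  obtain ⟨t, rfl⟩ := hq
  have hη : (ζ ^ (t + 1)) ^ 2 = ζ := by
    rw [← pow_mul, show (t + 1) * 2 = 2 * t + 1 + 1 by ring, pow_succ, hζ, one_mul]
  obtain ⟨u, v, huv⟩ := exists_sq_add_sq_mul_one_sub (ζ ^ (t + 1)) m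
  obtain ⟨c, hc⟩ := hm
  have h2 : ζ ^ 2 ^ m * ζ = 1 := by rw [← pow_succ, hc, pow_mul, hζ, one_pow]
  rw [hη] at huv
  refine ⟨u * ζ ^ (t + 1), v * ζ ^ (t + 1), ?_⟩
  apply mul_left_cancel₀ (sub_ne_zero.2 h1.symm)
  linear_combination (1 - ζ) * (u ^ 2 + v ^ 2) * hη + ζ * huv - h2

theorem exists_dvd_two_pow_add_one {q : ℕ} (hq : q.Prime) (hq2 : Odd q)
    (h : ¬ Odd (orderOf (2 : ZMod q))) : ∃ m, q ∣ 2 ^ m + 1 := by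
  have : Fact q.Prime := ⟨hq⟩
  obtain ⟨m, hm⟩ := Nat.not_odd_iff_even.1 h
  have h2 : (2 : ZMod q) ≠ 0 := by
    intro h0
    have := (ZMod.natCast_eq_zero_iff 2 q).1 (by exact_mod_cast h0)
    rw [(Nat.prime_dvd_prime_iff_eq hq Nat.prime_two).1 this] at hq2
    exact absurd hq2 (by decide)
  have hpos : 0 < orderOf (2 : ZMod q) := by
    have := orderOf_pos (Units.mk0 (2 : ZMod q) h2)
    rwa [← orderOf_units] at this
  refine ⟨m, ?_⟩
  rw [← ZMod.natCast_eq_zero_iff]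
  push_cast
  have hsq : ((2 : ZMod q) ^ m) ^ 2 = 1 := by
    rw [← pow_mul, mul_two, ← hm, pow_orderOf_eq_one]
  rcases mul_self_eq_one_iff.1 ((sq _).symm.trans hsq) with h3 | h3
  · have := orderOf_le_of_pow_eq_one (by omega) h3
    omega
  · rw [h3]; ring

theorem exists_monoidHom_complex_apply_ne_one {A : Type*} [CommGroup A] [Finite A] {g : A}
    (hg : g ≠ 1) : ∃ χ : A →* ℂ, χ g ≠ 1 := by
  obtain ⟨χ, hχ⟩ := CommGroup.exists_apply_ne_one_of_hasEnoughRootsOfUnity A ℂ hg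
  exact ⟨(Units.coeHom ℂ).comp χ, fun h => hχ (Units.ext h)⟩

theorem odd_orderOf_two_of_isReduced {A : Type*} [CommGroup A] [Finite A]
    (hred : IsReduced (MonoidAlgebra ℚ (QuaternionGroup 2 × A))) {q : ℕ} (hq : q.Prime)
    (hq2 : Odd q) (hqA : q ∣ Nat.card A) : Odd (orderOf (2 : ZMod q)) := by
  by_contra h
  have : Fact q.Prime := ⟨hq⟩
  obtain ⟨m, hm⟩ := exists_dvd_two_pow_add_one hq hq2 h
  obtain ⟨g, hg⟩ := exists_prime_orderOf_dvd_card' q hqA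
  obtain ⟨χ, hχ⟩ := exists_monoidHom_complex_apply_ne_one (g := g) (by
    rintro rfl
    exact hq.one_lt.ne (by simpa using hg))
  have hmem : χ g ∈ Algebra.adjoin ℚ (Set.range χ) := Algebra.subset_adjoin ⟨g, rfl⟩
  obtain ⟨a, b, hab⟩ := exists_sq_add_sq_add_one_eq_zero_of_rootOfUnity hq2 hm
    (ζ := (⟨χ g, hmem⟩ : Algebra.adjoin ℚ (Set.range χ)))
    (fun h => hχ (congrArg Subtype.val h))
    (Subtype.ext (by simp [← map_pow, ← hg, pow_orderOf_eq_one]))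
  exact sq_add_sq_add_one_ne_zero hred χ a.2 b.2 (congrArg Subtype.val hab)

theorem eq_one_of_isReduced_real {A : Type*} [CommGroup A] [Finite A]
    (hred : IsReduced (MonoidAlgebra ℝ (QuaternionGroup 2 × A))) {n : ℕ} (hn : Odd n) {g : A}
    (hg : g ^ n = 1) : g = 1 := by
  by_contra h
  obtain ⟨χ, hχ⟩ := exists_monoidHom_complex_apply_ne_one h
  have hmem : χ g ∈ Algebra.adjoin ℝ (Set.range χ) := Algebra.subset_adjoin ⟨g, rfl⟩
  have hζ : χ g ^ n = 1 := by rw [← map_pow, hg, map_one]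
  have him : (χ g).im ≠ 0 := by
    intro h0
    obtain ⟨r, hr⟩ : ∃ r : ℝ, (r : ℂ) = χ g := ⟨(χ g).re, Complex.ext rfl h0.symm⟩
    rw [← hr] at hζ hχ
    have h1 : r ^ n = 1 ^ n := by rw [one_pow]; exact_mod_cast hζ
    exact hχ (by rw [hn.pow_injective h1, Complex.ofReal_one])
  have hI : Complex.I ∈ Algebra.adjoin ℝ (Set.range χ) := by
    have : Complex.I = (χ g).im⁻¹ • (χ g - algebraMap ℝ ℂ (χ g).re) := by
      rw [Complex.real_smul]
      apply Complex.ext <;> simp [him]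
    rw [this]
    exact Subalgebra.smul_mem _ (sub_mem hmem (Subalgebra.algebraMap_mem _ _)) _
  exact sq_add_sq_add_one_ne_zero hred χ hI (zero_mem _) (by simp)

theorem PadicInt.exists_sq_add_sq_add_one_eq_zero {p : ℕ} [Fact p.Prime] (hp : Odd p) :
    ∃ a b : ℤ_[p], a ^ 2 + b ^ 2 + 1 = 0 := by
  obtain ⟨x, y, hxy⟩ : ∃ x y : ℤ, (p : ℤ) ∣ x ^ 2 + y ^ 2 + 1 := by
    obtain ⟨x, y, h⟩ := ZMod.sq_add_sq p (-1)
    obtain ⟨x, rfl⟩ := ZMod.intCast_surjective x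
    obtain ⟨y, rfl⟩ := ZMod.intCast_surjective y
    refine ⟨x, y, ?_⟩
    rw [← ZMod.intCast_zmod_eq_zero_iff_dvd]
    push_cast
    rw [h]
    ring
  have hprime : Prime (p : ℤ) := Nat.prime_iff_prime_int.1 Fact.out
  wlog hx : ¬ (p : ℤ) ∣ x generalizing x y
  · refine this y x (by rwa [add_comm (y ^ 2)]) fun hy => hprime.not_dvd_one ?_
    have h2 := dvd_add (dvd_pow (not_not.1 hx) two_ne_zero) (dvd_pow hy two_ne_zero)
    exact (dvd_add_right h2).1 hxy
  have h2x : ¬ (p : ℤ) ∣ 2 * x := fun h => by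
    rcases hprime.dvd_or_dvd h with h | h
    · have h2 : p ∣ 2 := by exact_mod_cast h
      rw [(Nat.prime_dvd_prime_iff_eq Fact.out Nat.prime_two).1 h2] at hp
      exact absurd hp (by decide)
    · exact hx h
  have hnorm2 : ‖((2 * x : ℤ) : ℤ_[p])‖ = 1 :=
    le_antisymm (PadicInt.norm_le_one _)
      (not_lt.1 fun h => h2x ((PadicInt.norm_int_lt_one_iff_dvd _).1 h))
  have hnorm1 := (PadicInt.norm_int_lt_one_iff_dvd (p := p) _).2 hxy
  obtain ⟨c, hc⟩ : ∃ c : ℤ_[p], c = (y : ℤ_[p]) ^ 2 + 1 := ⟨_, rfl⟩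
  push_cast at hnorm1 hnorm2
  rw [add_assoc, ← hc] at hnorm1
  obtain ⟨z, hz, -⟩ := hensels_lemma (p := p)
    (F := (Polynomial.X ^ 2 + Polynomial.C c : Polynomial ℤ_[p]))
    (a := (x : ℤ_[p])) (by simpa [hnorm2, one_add_one_eq_two] using hnorm1)
  exact ⟨z, y, by simpa [hc, add_assoc] using hz⟩

section

variable {G : Type*} [Group G]

theorem pow_mul_pow_eq_of_mul_eq {x y e : G} (h : x * y = y * x * e) (hx : Commute e x)
    (hy : Commute e y) (i j : ℕ) : x ^ i * y ^ j = y ^ j * x ^ i * e ^ (i * j) := by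
  have h1 (i : ℕ) : x ^ i * y = y * x ^ i * e ^ i := by
    induction i with
    | zero => simp
    | succ i ih =>
      calc x ^ (i + 1) * y = x * (x ^ i * y) := by rw [pow_succ', mul_assoc]
        _ = x * y * x ^ i * e ^ i := by rw [ih]; simp only [mul_assoc]
        _ = y * x * (e * x ^ i) * e ^ i := by rw [h]; simp only [mul_assoc]
        _ = y * x ^ (i + 1) * e ^ (i + 1) := by
          rw [(hx.pow_right i).eq, pow_succ', pow_succ']; simp only [mul_assoc]
  induction j with
  | zero => simp
  | succ j ih =>
    calc x ^ i * y ^ (j + 1) = x ^ i * y ^ j * y := by rw [pow_succ, mul_assoc]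
      _ = y ^ j * x ^ i * (e ^ (i * j) * y) := by rw [ih]; simp only [mul_assoc]
      _ = y ^ j * (x ^ i * y) * e ^ (i * j) := by rw [(hy.pow_left _).eq]; simp only [mul_assoc]
      _ = y ^ (j + 1) * x ^ i * e ^ (i * (j + 1)) := by
        rw [h1, pow_succ, mul_add_one, add_comm, pow_add]; simp only [mul_assoc]

theorem mul_pow_eq_of_mul_eq {x y e : G} (h : x * y = y * x * e) (hx : Commute e x)
    (hy : Commute e y) (n : ℕ) : (y * x) ^ n = y ^ n * x ^ n * e ^ n.choose 2 := by
  induction n with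
  | zero => simp
  | succ n ih =>
    have h1 := pow_mul_pow_eq_of_mul_eq h hx hy n 1
    rw [pow_one, mul_one] at h1
    calc (y * x) ^ (n + 1) = y ^ n * x ^ n * (e ^ n.choose 2 * (y * x)) := by
          rw [pow_succ, ih, mul_assoc]
      _ = y ^ n * (x ^ n * y) * x * e ^ n.choose 2 := by
          rw [((hy.mul_right hx).pow_left _).eq]; simp only [mul_assoc]
      _ = y ^ n * y * x ^ n * (e ^ n * x) * e ^ n.choose 2 := by
          rw [h1]; simp only [mul_assoc]
      _ = y ^ (n + 1) * x ^ (n + 1) * e ^ (n + 1).choose 2 := by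
          rw [(hx.pow_left n).eq, pow_succ, pow_succ, Nat.choose_succ_succ' n 1, Nat.choose_one_right,
            pow_add]
          simp only [mul_assoc]

theorem exists_pow_eq_of_mem_zpowers {x c : G} {p a : ℕ} (hp : p.Prime)
    (hx : orderOf x = p ^ (a + 1)) (hc : c ∈ Subgroup.zpowers x) (hcp : c ^ p = 1) (hc1 : c ≠ 1) :
    ∃ m, ¬ p ∣ m ∧ (x ^ m) ^ p ^ a = c := by
  have hfin : IsOfFinOrder x := orderOf_pos_iff.1 (by rw [hx]; exact pow_pos hp.pos _)
  obtain ⟨k, rfl⟩ := (Submonoid.mem_powers_iff _ _).1 (hfin.mem_powers_iff_mem_zpowers.2 hc)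
  rw [← pow_mul, ← orderOf_dvd_iff_pow_eq_one, hx, pow_succ] at hcp
  obtain ⟨m, rfl⟩ := Nat.dvd_of_mul_dvd_mul_right hp.pos hcp
  refine ⟨m, fun ⟨t, ht⟩ => hc1 ?_, by rw [← pow_mul, mul_comm]⟩
  rw [ht, ← mul_assoc, ← pow_succ, ← hx, pow_mul, pow_orderOf_eq_one, one_pow]

variable [Finite G]

/-- A minimal noncommuting pair in a finite group all of whose cyclic subgroups are normal
generates a quaternion group. -/
theorem exists_quaternion_relations (D : ∀ g h : G, g * h * g⁻¹ ∈ Subgroup.zpowers h)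
    (hne : ¬ ∀ a b : G, a * b = b * a) :
    ∃ x y : G, x ^ 4 = 1 ∧ x ^ 2 ≠ 1 ∧ y ^ 2 = x ^ 2 ∧ x * y = y * x ^ 3 := by
  obtain ⟨x, y, hxy, hle, hmin⟩ : ∃ x y : G, ¬ Commute x y ∧ orderOf y ≤ orderOf x ∧
      ∀ x' y' : G, ¬ Commute x' y' → orderOf x + orderOf y ≤ orderOf x' + orderOf y' := by
    have hne' : ∃ P : G × G, ¬ Commute P.1 P.2 := by
      by_contra! h
      exact hne fun a b => (h (a, b)).eq
    obtain ⟨P, hP, hPmin⟩ := WellFounded.has_min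
      (measure fun P : G × G => orderOf P.1 + orderOf P.2).wf {P | ¬ Commute P.1 P.2} hne'
    have hPmin' (x' y' : G) (h : ¬ Commute x' y') :
        orderOf P.1 + orderOf P.2 ≤ orderOf x' + orderOf y' := not_lt.1 (hPmin (x', y') h)
    rcases le_total (orderOf P.2) (orderOf P.1) with h | h
    · exact ⟨P.1, P.2, hP, h, hPmin'⟩
    · exact ⟨P.2, P.1, fun h' => hP h'.symm, h, fun x' y' h' => by
        rw [add_comm]; exact hPmin' x' y' h'⟩
  obtain ⟨e, he⟩ : ∃ e, e = x⁻¹ * y⁻¹ * x * y := ⟨_, rfl⟩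
  have hrel : x * y = y * x * e := by rw [he]; group
  have hex : e ∈ Subgroup.zpowers x := by
    rw [he, mul_assoc, mul_assoc]
    exact mul_mem (inv_mem (Subgroup.mem_zpowers x)) (by simpa [mul_assoc] using D y⁻¹ x)
  have hey : e ∈ Subgroup.zpowers y := by
    rw [he]
    exact mul_mem (by simpa [mul_assoc] using inv_mem (D x⁻¹ y)) (Subgroup.mem_zpowers y)
  have hcx : Commute e x := by
    obtain ⟨k, rfl⟩ := Subgroup.mem_zpowers_iff.1 hex
    exact (Commute.refl x).zpow_left k
  have hcy : Commute e y := by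
    obtain ⟨k, rfl⟩ := Subgroup.mem_zpowers_iff.1 hey
    exact (Commute.refl y).zpow_left k
  have he1 : e ≠ 1 := by
    rintro rfl
    exact hxy (by rw [mul_one] at hrel; exact hrel)
  have hpow := pow_mul_pow_eq_of_mul_eq hrel hcx hcy
  have hcomm (i j : ℕ) : Commute (x ^ i) (y ^ j) ↔ e ^ (i * j) = 1 := by
    rw [Commute, SemiconjBy, hpow, mul_eq_left]
  have horder (g : G) (q : ℕ) (hq : q.Prime) (hqg : q ∣ orderOf g) :
      orderOf (g ^ q) < orderOf g := by
    rw [orderOf_pow_of_dvd hq.ne_zero hqg]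
    exact Nat.div_lt_self (orderOf_pos g) hq.one_lt
  have hqx (q : ℕ) (hq : q.Prime) (h : q ∣ orderOf x) : e ^ q = 1 := by
    by_contra h1
    have h2 := hmin (x ^ q) (y ^ 1) (by rwa [hcomm, mul_one])
    have h3 := horder x q hq h
    rw [pow_one] at h2
    omega
  have hqy (q : ℕ) (hq : q.Prime) (h : q ∣ orderOf y) : e ^ q = 1 := by
    by_contra h1
    have h2 := hmin (x ^ 1) (y ^ q) (by rwa [hcomm, one_mul])
    have h3 := horder y q hq h
    rw [pow_one] at h2
    omega
  obtain ⟨p, hp, hpx⟩ : ∃ p : ℕ, p.Prime ∧ p ∣ orderOf x := by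
    refine Nat.exists_prime_and_dvd fun h => hxy ?_
    rw [orderOf_eq_one_iff.1 h]
    exact Commute.one_left y
  have hep := hqx p hp hpx
  have : Fact p.Prime := ⟨hp⟩
  have hoe : orderOf e = p := orderOf_eq_prime hep he1
  have huniq (q : ℕ) (hq : q.Prime) (h : e ^ q = 1) : q = p := by
    rw [← orderOf_dvd_iff_pow_eq_one, hoe] at h
    exact ((Nat.prime_dvd_prime_iff_eq hp hq).1 h).symm
  obtain ⟨a, ha⟩ : ∃ a, orderOf x = p ^ a := ⟨_, Nat.eq_prime_pow_of_unique_prime_dvd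
    (orderOf_pos x).ne' fun {q} hq h => huniq q hq (hqx q hq h)⟩
  obtain ⟨b, hb⟩ : ∃ b, orderOf y = p ^ b := ⟨_, Nat.eq_prime_pow_of_unique_prime_dvd
    (orderOf_pos y).ne' fun {q} hq h => huniq q hq (hqy q hq h)⟩
  rw [ha, hb, Nat.pow_le_pow_iff_right hp.one_lt] at hle
  obtain _ | b := b
  · rw [pow_zero, orderOf_eq_one_iff] at hb
    exact absurd (hb ▸ Commute.one_right x) hxy
  obtain ⟨s, rfl⟩ : ∃ s, a = b + s + 1 := ⟨a - (b + 1), by omega⟩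
  obtain ⟨m, hm, hX⟩ := exists_pow_eq_of_mem_zpowers hp ha hex hep he1
  obtain ⟨n, hn, hY⟩ := exists_pow_eq_of_mem_zpowers hp hb (inv_mem hey)
    (by rw [inv_pow, hep, inv_one]) (inv_ne_one.2 he1)
  have hmn : ¬ p ∣ m * n := hp.not_dvd_mul hm hn
  have hrel' : x ^ (m * p ^ s) * y ^ n = y ^ n * x ^ (m * p ^ s) * e ^ (m * p ^ s * n) := hpow _ _
  have hw := mul_pow_eq_of_mul_eq hrel' ((hcx.pow_right _).pow_left _)
    ((hcy.pow_right _).pow_left _) (p ^ b)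
  have hX' : (x ^ (m * p ^ s)) ^ p ^ b = e := by
    rw [← hX, ← pow_mul, ← pow_mul, mul_assoc, ← pow_add, add_comm s b]
  rw [hY, hX', inv_mul_cancel, one_mul, ← pow_mul] at hw
  have hnw : ¬ Commute (x ^ m) (y ^ n * x ^ (m * p ^ s)) := by
    intro h
    have h2 := h.mul_right ((Commute.refl x).pow_pow m (m * p ^ s)).inv_right
    rw [mul_inv_cancel_right, hcomm, ← orderOf_dvd_iff_pow_eq_one, hoe] at h2
    exact hmn h2
  have hpnd : ¬ p ∣ m * p ^ s * n * (p ^ b).choose 2 := by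
    intro h
    have h0 := orderOf_dvd_iff_pow_eq_one.1 (hoe.dvd.trans h)
    rw [h0, ← orderOf_dvd_iff_pow_eq_one] at hw
    have h1 := Nat.le_of_dvd (pow_pos hp.pos _) hw
    have h2 := hmin _ _ hnw
    have h3 := Nat.le_of_dvd (orderOf_pos x) (orderOf_pow_dvd (x := x) m)
    have h4 := Nat.pow_lt_pow_right hp.one_lt (Nat.lt_add_one b)
    omega
  obtain rfl : s = 0 := by
    by_contra h
    exact hpnd ((((dvd_pow_self p h).mul_left m).mul_right n).mul_right _)
  have h2 : 2 = p ^ b := by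
    by_contra h
    exact hpnd ((hp.dvd_choose_pow two_ne_zero h).mul_left _)
  obtain rfl : p = 2 := by
    refine (Nat.prime_dvd_prime_iff_eq hp Nat.prime_two).1 ?_
    rw [h2]
    refine dvd_pow_self p ?_
    rintro rfl
    simp at h2
  obtain rfl : b = 1 := (Nat.pow_right_injective le_rfl (by simpa using h2)).symm
  have heinv : e⁻¹ = e := inv_eq_of_mul_eq_one_right (by rw [← sq, hep])
  rw [add_zero, pow_one] at hX
  rw [pow_one, heinv] at hY
  have hemn : e ^ (m * n) = e := by
    rw [← pow_mod_orderOf, hoe, Nat.two_dvd_ne_zero.1 hmn, pow_one]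
  refine ⟨x ^ m, y ^ n, ?_, by rwa [hX], by rw [hX, hY], ?_⟩
  · rw [show 4 = 2 * 2 from rfl, pow_mul, hX, hep]
  · rw [hpow, hemn, pow_succ' _ 2, hX, mul_assoc]

end

section

variable {G : Type*} [Group G]

theorem quaternionLift_injective {x y : G} (hx : x ^ 4 = 1) (hx2 : x ^ 2 ≠ 1) (hy : y ^ 2 = x ^ 2)
    (hxy : x * y = y * x ^ 3) : Function.Injective (quaternionLift x y hx hy hxy) := by
  have key (n : ℕ) (h : Commute x (y * x ^ n)) : False := by
    have h2 : Commute x y := by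
      have := h.mul_right ((Commute.refl x).pow_right n).inv_right
      rwa [mul_inv_cancel_right] at this
    rw [h2.eq, mul_right_inj, pow_succ, right_eq_mul] at hxy
    exact hx2 hxy
  rw [injective_iff_map_eq_one]
  rintro (i | i) h
  · have h1 : orderOf x = 2 ^ 2 := orderOf_eq_prime_pow (by simpa using hx2) (by simpa using hx)
    rw [quaternionLift_a, ← orderOf_dvd_iff_pow_eq_one, h1] at h
    have : i = 0 := by
      revert i; decide
    rw [this]; rfl
  · rw [quaternionLift_xa] at h
    exact (key _ (h ▸ Commute.one_right x)).elim

theorem conj_eq_or_eq_inv (D : ∀ g h : G, g * h * g⁻¹ ∈ Subgroup.zpowers h) {h : G}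
    (h4 : h ^ 4 = 1) (h2 : h ^ 2 ≠ 1) (g : G) : g * h * g⁻¹ = h ∨ g * h * g⁻¹ = h⁻¹ := by
  obtain ⟨k, hk⟩ := Subgroup.mem_zpowers_iff.1 (D g h)
  have hz (j : ℤ) : h ^ (4 * j) = 1 := by
    rw [zpow_mul]
    exact_mod_cast congrArg (· ^ j) h4 |>.trans (one_zpow j)
  have hk4 : h ^ k = h ^ (k % 4) := by
    conv_lhs => rw [← Int.mul_ediv_add_emod k 4, zpow_add, hz, one_mul]
  have hc : g * h ^ 2 * g⁻¹ = (h ^ (k % 4)) ^ 2 := by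
    rw [← hk4, hk, conj_pow]
  have hlo := Int.emod_nonneg k (show (4 : ℤ) ≠ 0 by decide)
  have hhi := Int.emod_lt_of_pos k (show (0 : ℤ) < 4 by decide)
  rw [← hk, hk4]
  generalize k % 4 = r at *
  interval_cases r
  · rw [zpow_zero, one_pow, conj_eq_one_iff] at hc
    exact absurd hc h2
  · exact .inl (zpow_one h)
  · have : (h ^ (2 : ℤ)) ^ 2 = 1 := by
      rw [← h4, zpow_ofNat, ← pow_mul]
    rw [this, conj_eq_one_iff] at hc
    exact absurd hc h2
  · right
    rw [eq_inv_iff_mul_eq_one, ← h4, zpow_ofNat, ← pow_succ]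

section

variable (D : ∀ g h : G, g * h * g⁻¹ ∈ Subgroup.zpowers h) {φ : QuaternionGroup 2 →* G}
  (hφ : Function.Injective φ)
include D hφ

open QuaternionGroup

theorem exists_mul_commute_quaternion (g : G) :
    ∃ q c, (∀ q', Commute (φ q') c) ∧ φ q * c = g := by
  have hconj (t : QuaternionGroup 2) (ht : t ^ 2 ≠ 1) :
      g * φ t * g⁻¹ = φ t ∨ g * φ t * g⁻¹ = φ t⁻¹ := by
    rw [map_inv]
    refine conj_eq_or_eq_inv D ?_ ?_ g
    · rw [← map_pow, show t ^ 4 = 1 by revert t; decide, map_one]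
    · rwa [← map_pow, Ne, map_eq_one_iff φ hφ]
  obtain ⟨q, hq1, hq2⟩ : ∃ q, g * φ (a 1) * g⁻¹ = φ (q * a 1 * q⁻¹) ∧
      g * φ (xa 0) * g⁻¹ = φ (q * xa 0 * q⁻¹) := by
    rcases hconj (a 1) (by decide) with h1 | h1 <;> rcases hconj (xa 0) (by decide) with h2 | h2 <;>
      rw [h1, h2]
    · exact ⟨1, by simp⟩
    · exact ⟨a 1, congrArg φ (by decide), congrArg φ (by decide)⟩
    · exact ⟨xa 0, congrArg φ (by decide), congrArg φ (by decide)⟩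
    · exact ⟨xa 1, congrArg φ (by decide), congrArg φ (by decide)⟩
  have hc (t : QuaternionGroup 2) (h : g * φ t * g⁻¹ = φ (q * t * q⁻¹)) :
      Commute (φ t) ((φ q)⁻¹ * g) := by
    rw [map_mul, map_mul, map_inv, mul_inv_eq_iff_eq_mul] at h
    rw [Commute, SemiconjBy, mul_assoc, h]
    group
  refine ⟨q, (φ q)⁻¹ * g, fun q' => ?_, mul_inv_cancel_left _ _⟩
  have hgen : ∃ i j : ℕ, q' = xa 0 ^ i * a 1 ^ j := by
    have : ∀ q' : QuaternionGroup 2, ∃ i ∈ Finset.range 2, ∃ j ∈ Finset.range 4,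
      q' = xa 0 ^ i * a 1 ^ j := by decide
    obtain ⟨i, -, j, -, h⟩ := this q'
    exact ⟨i, j, h⟩
  obtain ⟨i, j, rfl⟩ := hgen
  rw [map_mul, map_pow, map_pow]
  exact ((hc _ hq2).pow_left i).mul_left ((hc _ hq1).pow_left j)

theorem sq_eq_one_of_commute_quaternion {c : G} (hc : ∀ q, Commute (φ q) c) (h4 : c ^ 4 = 1) :
    c ^ 2 = 1 := by
  have hne : (φ (a 1))⁻¹ ≠ φ (a 1) := by
    rw [← map_inv]
    exact fun h => absurd (hφ h) (by decide)
  have hinv : φ (xa 0) * φ (a 1) * (φ (xa 0))⁻¹ = (φ (a 1))⁻¹ := by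
    rw [← map_inv, ← map_inv, ← map_mul, ← map_mul]
    exact congrArg φ (by decide)
  have hx4 : φ (a 1) ^ 4 = 1 := by
    rw [← map_pow, show (a 1 : QuaternionGroup 2) ^ 4 = 1 by decide, map_one]
  have hconj : φ (xa 0) * (φ (a 1) * c) * (φ (xa 0))⁻¹ = (φ (a 1))⁻¹ * c := by
    rw [← hinv, mul_assoc, mul_assoc, ← (hc (xa 0)).inv_left.eq]
    simp only [mul_assoc]
  by_cases h2 : (φ (a 1) * c) ^ 2 = 1
  · obtain ⟨k, hk⟩ := Subgroup.mem_zpowers_iff.1 (D (φ (xa 0)) (φ (a 1) * c))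
    rw [hconj] at hk
    exfalso
    have h2z : (φ (a 1) * c) ^ (2 : ℤ) = 1 := by exact_mod_cast h2
    rcases Int.even_or_odd' k with ⟨j, rfl | rfl⟩
    · rw [zpow_mul, h2z, one_zpow] at hk
      rw [← hk, conj_eq_one_iff] at hconj
      exact hne (mul_right_cancel (hk.symm.trans hconj.symm))
    · rw [zpow_add_one, zpow_mul, h2z, one_zpow, one_mul] at hk
      exact hne (mul_right_cancel hk).symm
  · rcases conj_eq_or_eq_inv D (by rw [(hc (a 1)).mul_pow, hx4, h4, one_mul]) h2 (φ (xa 0))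
      with h | h <;> rw [hconj] at h
    · exact absurd (mul_right_cancel h) hne
    · rw [((hc (a 1)).mul_inv), mul_right_inj, eq_inv_iff_mul_eq_one] at h
      rw [sq, h]

end

/-- A nonabelian finite group all of whose cyclic subgroups are normal is generated by a quaternion
subgroup and its centralizer, which is abelian without elements of order four. -/
theorem exists_quaternion_and_centralizer [Finite G]
    (D : ∀ g h : G, g * h * g⁻¹ ∈ Subgroup.zpowers h) (hne : ¬ ∀ a b : G, a * b = b * a) :
    ∃ φ : QuaternionGroup 2 →* G, Function.Injective φ ∧
      (∀ g, ∃ q, ∃ c, (∀ q', Commute (φ q') c) ∧ φ q * c = g) ∧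
      (∀ c c', (∀ q, Commute (φ q) c) → (∀ q, Commute (φ q) c') → c * c' = c' * c) ∧
      ∃ m, Odd m ∧ ∀ c, (∀ q, Commute (φ q) c) → c ^ (2 * m) = 1 := by
  obtain ⟨x, y, hx, hx2, hy, hxy⟩ := exists_quaternion_relations D hne
  refine ⟨quaternionLift x y hx hy hxy, quaternionLift_injective hx hx2 hy hxy, ?_⟩
  have hφ := quaternionLift_injective hx hx2 hy hxy
  generalize quaternionLift x y hx hy hxy = φ at hφ ⊢
  refine ⟨exists_mul_commute_quaternion D hφ, fun c c' hc hc' => ?_, ?_⟩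
  · by_contra h
    let C : Subgroup G := Subgroup.centralizer (Set.range φ)
    have hC : ∀ {c}, c ∈ C ↔ ∀ q, Commute (φ q) c := by
      intro c
      rw [Subgroup.mem_centralizer_iff, Set.forall_mem_range]
      rfl
    obtain ⟨x, -, h4, h2, -⟩ := exists_quaternion_relations (G := C)
      (fun g h => by
        obtain ⟨k, hk⟩ := Subgroup.mem_zpowers_iff.1 (D g h)
        exact Subgroup.mem_zpowers_iff.2 ⟨k, Subtype.ext hk⟩)
      (fun h' => h (congrArg Subtype.val (h' ⟨c, hC.2 hc⟩ ⟨c', hC.2 hc'⟩)))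
    exact h2 (Subtype.ext (sq_eq_one_of_commute_quaternion D hφ (hC.1 x.2)
      (congrArg Subtype.val h4)))
  · obtain ⟨s, m, hm, hG⟩ := Nat.exists_eq_two_pow_mul_odd (Nat.card_pos (α := G)).ne'
    refine ⟨m, hm, fun c hc => ?_⟩
    have key (s : ℕ) (d : G) (hd : ∀ q, Commute (φ q) d) (h : d ^ 2 ^ s = 1) : d ^ 2 = 1 := by
      induction s generalizing d with
      | zero => rw [pow_zero, pow_one] at h; rw [h, one_pow]
      | succ s ih =>
        refine sq_eq_one_of_commute_quaternion D hφ hd ?_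
        have := ih (d ^ 2) (fun q => (hd q).pow_right 2) (by rw [← pow_mul, ← pow_succ', h])
        rwa [← pow_mul] at this
    rw [mul_comm, pow_mul]
    refine key s _ (fun q => (hc q).pow_right m) ?_
    rw [← pow_mul, mul_comm, ← hG, pow_card_eq_one']

end

section

variable {G : Type*} [Group G] {φ : QuaternionGroup 2 →* G}

theorem noncommCoprod_injective_of_odd (hφ : Function.Injective φ) {N : Type*} [Group N]
    {f : N →* G} (hf : Function.Injective f) (comm : ∀ q n, Commute (φ q) (f n)) {m : ℕ}
    (hm : Odd m) (hN : ∀ n : N, n ^ m = 1) :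
    Function.Injective (φ.noncommCoprod f comm) := by
  rw [MonoidHom.noncommCoprod_injective]
  refine ⟨hφ, hf, ?_⟩
  rw [Subgroup.disjoint_def]
  rintro _ ⟨q, rfl⟩ ⟨n, hn⟩
  have h4 : q ^ 4 = 1 := by clear hn; revert q; decide
  rw [← orderOf_eq_one_iff]
  have hcop : Nat.Coprime 4 m := (Nat.coprime_two_left.2 hm).pow_left 2
  refine Nat.eq_one_of_dvd_coprimes hcop ?_ ?_
  · rw [orderOf_dvd_iff_pow_eq_one, ← map_pow, h4, map_one]
  · rw [orderOf_dvd_iff_pow_eq_one, ← hn, ← map_pow, hN, map_one]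

theorem isReduced_quaternion_prod_of_odd {K : Type*} [Field K] (hφ : Function.Injective φ)
    [IsReduced (MonoidAlgebra K G)] {N : Type*} [Group N]
    {f : N →* G} (hf : Function.Injective f) (comm : ∀ q n, Commute (φ q) (f n)) {m : ℕ}
    (hm : Odd m) (hN : ∀ n : N, n ^ m = 1) :
    IsReduced (MonoidAlgebra K (QuaternionGroup 2 × N)) :=
  isReduced_of_injective_hom _ (noncommCoprod_injective_of_odd hφ hf comm hm hN)

theorem exists_mulEquiv_quaternionGroup_prod [Finite G] (hφ : Function.Injective φ)
    (hsurj : ∀ g, ∃ q, ∃ c, (∀ q', Commute (φ q') c) ∧ φ q * c = g)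
    {C : Subgroup G} (hC : ∀ {c}, c ∈ C ↔ ∀ q, Commute (φ q) c) (hC2 : ∀ c ∈ C, c ^ 2 = 1)
    (hcomm : ∀ c ∈ C, ∀ c' ∈ C, c * c' = c' * c) :
    ∃ r : ℕ, Nonempty (G ≃* QuaternionGroup 2 × (Fin r → Multiplicative (ZMod 2))) := by
  let _ : CommGroup C :=
    { (inferInstance : Group C) with
      mul_comm := fun c c' => Subtype.ext (hcomm c c.2 c' c'.2) }
  have hz : φ (.a 2) ∈ C := hC.2 fun q => by
    rw [Commute, SemiconjBy, ← map_mul, ← map_mul]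
    exact congrArg φ (by revert q; decide)
  have hz2 : φ (.a 2) * φ (.a 2) = 1 := by
    rw [← map_mul, ← map_one φ]
    exact congrArg φ (by decide)
  obtain ⟨χ, hχ⟩ := exists_monoidHom_complex_apply_ne_one (g := (⟨φ (.a 2), hz⟩ : C))
    fun h => absurd ((map_eq_one_iff φ hφ).1 (congrArg Subtype.val h)) (by decide)
  have hχ2 (c : C) : χ c = 1 ∨ χ c = -1 := by
    refine mul_self_eq_one_iff.1 ?_
    have hc : c ^ 2 = 1 := Subtype.ext (hC2 c c.2)
    rw [← map_mul, ← sq, hc, map_one]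
  obtain ⟨r, ⟨e⟩⟩ := exists_mulEquiv_pi_zmod_two (E := χ.ker) fun g =>
    Subtype.ext (Subtype.ext (hC2 g g.1.2))
  have hcom : ∀ q (n : χ.ker), Commute (φ q) ((C.subtype.comp χ.ker.subtype) n) :=
    fun q n => hC.1 n.1.2 q
  refine ⟨r, ⟨((MulEquiv.ofBijective (φ.noncommCoprod (C.subtype.comp χ.ker.subtype) hcom)
    ⟨?_, ?_⟩).symm.trans ((MulEquiv.refl _).prodCongr e))⟩⟩
  · rw [MonoidHom.noncommCoprod_injective]
    refine ⟨hφ, Subtype.val_injective.comp Subtype.val_injective, ?_⟩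
    rw [Subgroup.disjoint_def]
    rintro _ ⟨q, rfl⟩ ⟨n, hn⟩
    have hq : ∀ q', q' * q = q * q' := fun q' => hφ (by
      rw [map_mul, map_mul, ← hn]
      exact hcom q' n)
    have : q = 1 ∨ q = .a 2 := by
      clear hn
      revert q; decide
    rcases this with rfl | rfl
    · exact map_one φ
    · have : (⟨φ (.a 2), hz⟩ : C) = n.1 := Subtype.ext hn.symm
      rw [this] at hχ
      exact absurd n.2 hχ
  · intro g
    obtain ⟨q, c, hc, rfl⟩ := hsurj g
    rcases hχ2 ⟨c, hC.2 hc⟩ with h | h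
    · exact ⟨(q, ⟨⟨c, hC.2 hc⟩, h⟩), rfl⟩
    · refine ⟨(q * .a 2, ⟨⟨φ (.a 2), hz⟩ * ⟨c, hC.2 hc⟩, ?_⟩), ?_⟩
      · rw [MonoidHom.mem_ker, map_mul, h, (hχ2 _).resolve_left hχ]
        ring
      · change φ (q * .a 2) * (φ (.a 2) * c) = φ q * c
        rw [map_mul, mul_assoc, ← mul_assoc (φ (.a 2)), hz2, one_mul]

theorem isReduced_real_of_mulEquiv {r : ℕ}
    (e : G ≃* QuaternionGroup 2 × (Fin r → Multiplicative (ZMod 2))) :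
    IsReduced (MonoidAlgebra ℝ G) :=
  have := (fourSquaresAnisotropic_real.monoidAlgebra_pi r).isReduced_quaternionGroup_prod
  isReduced_of_injective_hom e.toMonoidHom e.injective

theorem isReduced_monoidAlgebra_of_algebra {K L : Type*} [Field K] [Field L] [Algebra K L]
    [IsReduced (MonoidAlgebra L G)] : IsReduced (MonoidAlgebra K G) :=
  isReduced_of_injective (mapRingHom G (algebraMap K L))
    (map_injective _ (algebraMap K L).injective)

variable [Finite G]

theorem isReduced_padic_two_of_isReduced_rat [IsReduced (MonoidAlgebra ℚ G)] :
    IsReduced (MonoidAlgebra ℚ_[2] G) := by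
  by_cases hne : ∀ a b : G, a * b = b * a
  · exact isReduced_of_comm hne
  obtain ⟨φ, hφ, hsurj, hcomm, m, hm, hpow⟩ :=
    exists_quaternion_and_centralizer (conj_mem_zpowers (K := ℚ) (G := G)) hne
  let C : Subgroup G := Subgroup.centralizer (Set.range φ)
  have hC : ∀ {c}, c ∈ C ↔ ∀ q, Commute (φ q) c := by
    intro c
    rw [Subgroup.mem_centralizer_iff, Set.forall_mem_range]
    rfl
  let _ : CommGroup C :=
    { (inferInstance : Group C) with
      mul_comm := fun c c' => Subtype.ext (hcomm c c' (hC.1 c.2) (hC.1 c'.2)) }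
  let A := (powMonoidHom m : C →* C).ker
  let E := (powMonoidHom 2 : C →* C).ker
  have hA (g : A) : g ^ m = 1 := Subtype.ext g.2
  have hE (g : E) : g ^ 2 = 1 := Subtype.ext g.2
  have hred : IsReduced (MonoidAlgebra ℚ (QuaternionGroup 2 × A)) :=
    isReduced_quaternion_prod_of_odd hφ (f := C.subtype.comp A.subtype)
      (Subtype.val_injective.comp Subtype.val_injective) (fun q n => hC.1 n.1.2 q) hm hA
  obtain ⟨k, hk, hkA⟩ := exists_odd_dvd_two_pow_sub_one (Nat.card A) Nat.card_pos.ne'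
    fun q hq hqA => by
      refine odd_orderOf_two_of_isReduced hred hq ?_ hqA
      have : Fact q.Prime := ⟨hq⟩
      obtain ⟨g, hg⟩ := exists_prime_orderOf_dvd_card' q hqA
      exact hm.of_dvd_nat (hg ▸ orderOf_dvd_of_pow_eq_one (hA g))
  have h1 : FourSquaresAnisotropic (MonoidAlgebra ℚ_[2] (E × A)) :=
    ((fourSquaresAnisotropic_padic hk fun g =>
      pow_two_pow_eq_self hkA pow_card_eq_one').monoidAlgebra_of_sq_eq_one hE).monoidAlgebra_prod
  have := h1.isReduced_quaternionGroup_prod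
  refine isReduced_of_surjective_hom (φ.noncommCoprod
    (C.subtype.comp (E.subtype.coprod A.subtype)) fun q n => hC.1 (SetLike.coe_mem _) q) ?_
  intro g
  obtain ⟨q, c, hc, rfl⟩ := hsurj g
  obtain ⟨t, ht⟩ : ∃ t, m + 1 = 2 * t := hm.add_one.two_dvd
  let c' : C := ⟨c, hC.2 hc⟩
  have hc' : c' ^ (2 * m) = 1 := Subtype.ext (hpow c hc)
  refine ⟨(q, ⟨(c' ^ m)⁻¹, ?_⟩, ⟨c' ^ (m + 1), ?_⟩), ?_⟩
  · change ((c' ^ m)⁻¹) ^ 2 = 1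
    rw [inv_pow, ← pow_mul, mul_comm, hc', inv_one]
  · change (c' ^ (m + 1)) ^ m = 1
    rw [← pow_mul, ht, mul_right_comm, pow_mul, hc', one_pow]
  · change φ q * (((c' ^ m)⁻¹ * c' ^ (m + 1) : C) : G) = φ q * c
    rw [pow_succ, inv_mul_cancel_left]

theorem comm_of_isReduced_padic {p : ℕ} [Fact p.Prime] (hp : Odd p)
    [IsReduced (MonoidAlgebra ℚ_[p] G)] : ∀ a b : G, a * b = b * a := by
  by_contra hne
  obtain ⟨φ, hφ, -⟩ :=
    exists_quaternion_and_centralizer (conj_mem_zpowers (K := ℚ_[p]) (G := G)) hne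
  have hred : IsReduced (MonoidAlgebra ℚ_[p] (QuaternionGroup 2 × Unit)) :=
    isReduced_quaternion_prod_of_odd hφ (f := (1 : Unit →* G)) (Function.injective_of_subsingleton _)
      (fun q n => Commute.one_right _) odd_one fun _ => rfl
  obtain ⟨x, y, hxy⟩ := PadicInt.exists_sq_add_sq_add_one_eq_zero hp
  exact sq_add_sq_add_one_ne_zero hred (1 : Unit →* ℚ_[p])
    (Subalgebra.algebraMap_mem _ (x : ℚ_[p])) (Subalgebra.algebraMap_mem _ (y : ℚ_[p]))
    (by simpa using congrArg ((↑) : ℤ_[p] → ℚ_[p]) hxy)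

theorem comm_or_exists_mulEquiv_of_isReduced_real [IsReduced (MonoidAlgebra ℝ G)] :
    (∀ a b : G, a * b = b * a) ∨
      ∃ r : ℕ, Nonempty (G ≃* QuaternionGroup 2 × (Fin r → Multiplicative (ZMod 2))) := by
  by_cases hne : ∀ a b : G, a * b = b * a
  · exact .inl hne
  right
  obtain ⟨φ, hφ, hsurj, hcomm, m, hm, hpow⟩ :=
    exists_quaternion_and_centralizer (conj_mem_zpowers (K := ℝ) (G := G)) hne
  let C : Subgroup G := Subgroup.centralizer (Set.range φ)
  have hC : ∀ {c}, c ∈ C ↔ ∀ q, Commute (φ q) c := by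
    intro c
    rw [Subgroup.mem_centralizer_iff, Set.forall_mem_range]
    rfl
  refine exists_mulEquiv_quaternionGroup_prod hφ hsurj hC (fun c hc => ?_)
    fun c hc c' hc' => hcomm c c' (hC.1 hc) (hC.1 hc')
  let _ : CommGroup C :=
    { (inferInstance : Group C) with
      mul_comm := fun c c' => Subtype.ext (hcomm c c' (hC.1 c.2) (hC.1 c'.2)) }
  let A := (powMonoidHom m : C →* C).ker
  have hA (g : A) : g ^ m = 1 := Subtype.ext g.2
  have hred : IsReduced (MonoidAlgebra ℝ (QuaternionGroup 2 × A)) :=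
    isReduced_quaternion_prod_of_odd hφ (f := C.subtype.comp A.subtype)
      (Subtype.val_injective.comp Subtype.val_injective) (fun q n => hC.1 n.1.2 q) hm hA
  have h1 : (⟨⟨c, hc⟩ ^ 2, Subtype.ext (by simpa [← pow_mul] using hpow c (hC.1 hc))⟩ : A) = 1 :=
    eq_one_of_isReduced_real hred hm (hA _)
  exact congrArg (fun a : A => ((a : C) : G)) h1

end

end

theorem stmt10 (G : Type*) [Group G] [Finite G] :
    (IsReduced (MonoidAlgebra ℚ_[2] G) ↔ IsReduced (MonoidAlgebra ℚ G)) ∧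
    (∀ (p : ℕ) [Fact p.Prime], Odd p →
      (IsReduced (MonoidAlgebra ℚ_[p] G) ↔ ∀ a b : G, a * b = b * a)) ∧
    (IsReduced (MonoidAlgebra ℝ G) ↔
      ((∀ a b : G, a * b = b * a) ∨
       ∃ r : ℕ, Nonempty
         (G ≃* QuaternionGroup 2 × (Fin r → Multiplicative (ZMod 2))))) := by
  refine ⟨⟨fun _ => isReduced_monoidAlgebra_of_algebra (L := ℚ_[2]),
    fun _ => isReduced_padic_two_of_isReduced_rat⟩,
    fun p _ hp => ⟨fun _ => comm_of_isReduced_padic hp, isReduced_of_comm⟩,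
    fun _ => comm_or_exists_mulEquiv_of_isReduced_real, ?_⟩
  rintro (h | ⟨r, ⟨e⟩⟩)
  · exact isReduced_of_comm h
  · exact isReduced_real_of_mulEquiv e
end

section
/- Let n > 1 be an odd integer and let F be the subfield of ℂ generated by √2 and a primitive n-th root of unity. Then −1 is a sum of two squares in F: there exist a, b ∈ F with a² + b² = −1. Consequently, the quaternion algebra (−1,−1) over F has zero divisors, i.e. ℍ ⊗_ℚ ℚ(√2, ε_n) is not a division ring. -/
/-- The subfield of `ℂ` generated by `√2` and a primitive `n`-th root of unity. -/
noncomputable def sqrt2CycField (n : ℕ) : Subfield ℂ :=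
  Subfield.closure {(Real.sqrt 2 : ℂ), Complex.exp (2 * Real.pi * Complex.I / n)}

open Polynomial in
theorem exists_map_eq_of_forall_galois_fixed {K L : Type*} [Field K] [Field L] [Algebra K L]
    [FiniteDimensional K L] [IsGalois K L] (p : L[X])
    (hp : ∀ σ : L ≃ₐ[K] L, p.map (σ : L →+* L) = p) :
    ∃ P : K[X], P.map (algebraMap K L) = p := by
  refine (mem_lifts p).1 ((lifts_iff_coeff_lifts p).2 fun k => ?_)
  refine (IsGalois.mem_range_algebraMap_iff_fixed (F := K) (p.coeff k)).2 fun σ => ?_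
  conv_rhs => rw [← hp σ]
  simp

open Polynomial in
/-- The product of `X - ψ r` over the residues `r` whose quadratic character is `e`. -/
noncomputable def quadraticClassPoly (q : ℕ) [Fact q.Prime] {L : Type*} [CommRing L]
    (ψ : AddChar (ZMod q) L) (e : ℤ) : L[X] :=
  ∏ r : ZMod q with quadraticChar (ZMod q) r = e, (X - C (ψ r))

open Polynomial in
theorem map_quadraticClassPoly (q : ℕ) [Fact q.Prime] {L : Type*} [CommRing L]
    (ψ : AddChar (ZMod q) L) (σ : L →+* L) (t : (ZMod q)ˣ) (ht : ∀ r, σ (ψ r) = ψ (t * r))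
    (e : ℤ) :
    (quadraticClassPoly q ψ e).map σ
      = quadraticClassPoly q ψ (quadraticChar (ZMod q) t * e) := by
  have hne : quadraticChar (ZMod q) t ≠ 0 := by
    rw [Ne, quadraticChar_eq_zero_iff]; exact t.ne_zero
  simp only [quadraticClassPoly, Polynomial.map_prod, Polynomial.map_sub, map_X, map_C, ht]
  refine Finset.prod_equiv (Units.mulLeft t) (fun r => ?_) (fun r _ => by simp)
  simp only [Finset.mem_filter, Finset.mem_univ, true_and, Units.mulLeft_apply, map_mul]
  exact (mul_right_inj' hne).symm

open Polynomial in
theorem X_sub_one_mul_quadraticClassPoly (q : ℕ) [Fact q.Prime] {L : Type*} [CommRing L]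
    [IsDomain L] {ξ : L} (hξ : IsPrimitiveRoot ξ q) :
    (X - 1) * (quadraticClassPoly q (AddChar.zmodChar q hξ.pow_eq_one) 1 *
      quadraticClassPoly q (AddChar.zmodChar q hξ.pow_eq_one) (-1)) = X ^ q - 1 := by
  have hq : 0 < q := (Fact.out : q.Prime).pos
  have hall : (X ^ q - 1 : L[X])
      = ∏ r : ZMod q, (X - C (AddChar.zmodChar q hξ.pow_eq_one r)) := by
    rw [X_pow_sub_one_eq_prod hq hξ]
    symm
    refine Finset.prod_bij (fun r _ => AddChar.zmodChar q hξ.pow_eq_one r) ?_ ?_ ?_ ?_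
    · intro r _
      rw [mem_nthRootsFinset hq, AddChar.zmodChar_apply, ← pow_mul, mul_comm, pow_mul,
        hξ.pow_eq_one, one_pow]
    · intro a _ b _ h
      exact ZMod.val_injective q (hξ.pow_inj (ZMod.val_lt a) (ZMod.val_lt b) h)
    · intro b hb
      obtain ⟨i, -, rfl⟩ := hξ.eq_pow_of_pow_eq_one ((mem_nthRootsFinset hq 1).1 hb)
      exact ⟨(i : ZMod q), Finset.mem_univ _, AddChar.zmodChar_apply' _ i⟩
    · intros; rfl
  rw [hall, ← Finset.mul_prod_erase Finset.univ _ (Finset.mem_univ (0 : ZMod q)),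
    AddChar.map_zero_eq_one, C_1, quadraticClassPoly, quadraticClassPoly, ← Finset.prod_union]
  · congr 2
    ext r
    simp only [Finset.mem_union, Finset.mem_filter, Finset.mem_univ, true_and, Finset.mem_erase,
      and_true]
    refine ⟨?_, fun h => quadraticChar_dichotomy h⟩
    rintro h rfl
    simp at h
  · rw [Finset.disjoint_filter]
    intro r _ h
    rw [h]; norm_num

open Polynomial in
/-- Gauss's formula `4 Φ_q = S ^ 2 + q D ^ 2` for primes `q ≡ 3 mod 4`, over `ℚ`. -/
theorem exists_X_sub_one_mul_sq_add_mul_sq (q : ℕ) [Fact q.Prime] (hq : q % 4 = 3) :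
    ∃ S D : ℚ[X], (X - 1) * (S ^ 2 + (q : ℚ[X]) * D ^ 2) = 4 * (X ^ q - 1) := by
  have hqp : q.Prime := Fact.out
  have : NeZero (q : ℚ) := ⟨Nat.cast_ne_zero.2 hqp.ne_zero⟩
  let L := CyclotomicField q ℚ
  have : IsCyclotomicExtension {q} ℚ L := CyclotomicField.isCyclotomicExtension q ℚ
  have : IsGalois ℚ L := IsCyclotomicExtension.isGalois {q} ℚ L
  have : FiniteDimensional ℚ L := IsCyclotomicExtension.finiteDimensional {q} ℚ L
  have hξ := IsCyclotomicExtension.zeta_spec q ℚ L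
  set ξ := IsCyclotomicExtension.zeta q ℚ L
  set ψ := AddChar.zmodChar q hξ.pow_eq_one with hψ
  let χ : MulChar (ZMod q) L := (quadraticChar (ZMod q)).ringHomComp (Int.castRingHom L)
  have hchar : ringChar (ZMod q) ≠ 2 := by
    rw [ZMod.ringChar_zmod_n]; omega
  have hχ2 : χ.IsQuadratic := (quadraticChar_isQuadratic (ZMod q)).comp _
  have hχ1 : χ ≠ 1 :=
    (MulChar.ringHomComp_ne_one_iff Int.cast_injective).2 (quadraticChar_ne_one hchar)
  have hneg : χ (-1) = -1 := by
    have : quadraticChar (ZMod q) (-1) = -1 := by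
      rw [quadraticChar_neg_one_iff_not_isSquare, FiniteField.isSquare_neg_one_iff, ZMod.card]
      simpa using hq
    simp [χ, MulChar.ringHomComp_apply, this]
  set g := gaussSum χ ψ with hg
  have hg2 : g ^ 2 = -(q : L) := by
    rw [hg, gaussSum_sq hχ1 hχ2 (AddChar.zmodChar_primitive_of_primitive_root q hξ), hneg,
      ZMod.card]
    ring
  have hq0 : (q : L) ≠ 0 := Nat.cast_ne_zero.2 hqp.ne_zero
  set P := quadraticClassPoly q ψ with hP
  have hgal (σ : L ≃ₐ[ℚ] L) : ((P 1).map (σ : L →+* L) = P 1 ∧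
      (P (-1)).map (σ : L →+* L) = P (-1) ∧ σ g = g) ∨ ((P 1).map (σ : L →+* L) = P (-1) ∧
      (P (-1)).map (σ : L →+* L) = P 1 ∧ σ g = -g) := by
    set t := hξ.autToPow ℚ σ
    have hσ (r : ZMod q) : (σ : L →+* L) (ψ r) = ψ (t * r) := by
      have h1 : σ ξ = ψ t := (hξ.autToPow_spec ℚ σ).symm
      rw [← ZMod.natCast_zmod_val r, mul_comm, ← nsmul_eq_mul, AddChar.map_nsmul_eq_pow, ← h1,
        hψ, AddChar.zmodChar_apply']
      simp
    have hmap := map_quadraticClassPoly q ψ (σ : L →+* L) t hσ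
    have hgσ : χ t * σ g = g := by
      rw [hg]
      conv_rhs => rw [← gaussSum_mulShift χ ψ t]
      congr 1
      simp only [gaussSum, map_sum, map_mul, AddChar.mulShift_apply]
      refine Finset.sum_congr rfl fun r _ => ?_
      rw [← hσ r]
      simp [χ, MulChar.ringHomComp_apply]
    rcases quadraticChar_dichotomy t.ne_zero with h | h
    · have hχt : χ t = 1 := by simp [χ, MulChar.ringHomComp_apply, h]
      rw [hχt, one_mul] at hgσ
      exact .inl ⟨by rw [hP, hmap, h, one_mul], by rw [hP, hmap, h, one_mul], hgσ⟩
    · have hχt : χ t = -1 := by simp [χ, MulChar.ringHomComp_apply, h]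
      rw [hχt] at hgσ
      exact .inr ⟨by rw [hP, hmap, h, mul_one], by rw [hP, hmap, h]; norm_num,
        by linear_combination -hgσ⟩
  obtain ⟨S, hS⟩ := exists_map_eq_of_forall_galois_fixed (K := ℚ) (P 1 + P (-1)) fun σ => by
    rcases hgal σ with ⟨h1, h2, -⟩ | ⟨h1, h2, -⟩
    · rw [Polynomial.map_add, h1, h2]
    · rw [Polynomial.map_add, h1, h2, add_comm]
  obtain ⟨D, hD⟩ := exists_map_eq_of_forall_galois_fixed (K := ℚ)
      (C (g / q) * (P 1 - P (-1))) fun σ => by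
    have hσC : (σ : L →+* L) (g / q) = σ g / q :=
      (map_div₀ σ g q).trans (by rw [map_natCast])
    rw [Polynomial.map_mul, Polynomial.map_sub, map_C, hσC]
    rcases hgal σ with ⟨h1, h2, h3⟩ | ⟨h1, h2, h3⟩
    · rw [h1, h2, h3]
    · rw [h1, h2, h3, neg_div, C_neg]
      ring
  refine ⟨S, D, map_injective (algebraMap ℚ L) (algebraMap ℚ L).injective ?_⟩
  have hprod := X_sub_one_mul_quadraticClassPoly q hξ
  rw [← hψ, ← hP] at hprod
  have hC : (q : L[X]) * C (g / q) ^ 2 = -1 := by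
    rw [← C_eq_natCast, ← C_pow, ← C_mul, div_pow, hg2]
    rw [show (q : L) * (-(q : L) / (q : L) ^ 2) = -1 by
      rw [neg_div, mul_neg, sq, div_mul_cancel_left₀ hq0, mul_inv_cancel₀ hq0]]
    simp
  simp only [Polynomial.map_mul, Polynomial.map_sub, Polynomial.map_add, Polynomial.map_pow,
    map_X, Polynomial.map_one, Polynomial.map_natCast, Polynomial.map_ofNat, hS, hD]
  rw [← hprod]
  linear_combination (X - 1) * (P 1 - P (-1)) ^ 2 * hC

theorem exists_sq_add_two_mul_sq_eq (q : ℕ) [Fact q.Prime] (hq : q % 8 = 3) :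
    ∃ a b : ℤ, a ^ 2 + 2 * b ^ 2 = q ∨ a ^ 2 + 2 * b ^ 2 = 2 * q := by
  have hq2 : q ≠ 2 := by omega
  obtain ⟨x, hx⟩ := (ZMod.exists_sq_eq_neg_two_iff hq2).2 (.inr hq)
  set s := Nat.sqrt q with hs
  have hsq : s * s < q := by
    refine lt_of_le_of_ne (Nat.sqrt_le q) fun h => ?_
    have := Nat.mul_mod s s 8
    have h8 : s % 8 < 8 := Nat.mod_lt _ (by norm_num)
    rw [h, hq] at this
    interval_cases s % 8 <;> omega
  have hcard : (Finset.univ : Finset (ZMod q)).card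
      < (Finset.range (s + 1) ×ˢ Finset.range (s + 1)).card := by
    rw [Finset.card_univ, ZMod.card, Finset.card_product, Finset.card_range]
    exact Nat.lt_succ_sqrt q
  obtain ⟨⟨a, b⟩, hab, ⟨c, d⟩, hcd, hne, hf⟩ :=
    Finset.exists_ne_map_eq_of_card_lt_of_maps_to hcard
    (f := fun y : ℕ × ℕ => (y.1 : ZMod q) - x * y.2)
    (fun _ _ => Finset.mem_coe.2 (Finset.mem_univ _))
  simp only [Finset.mem_product, Finset.mem_range] at hab hcd
  have hdvd : (q : ℤ) ∣ ((a : ℤ) - c) ^ 2 + 2 * ((b : ℤ) - d) ^ 2 := by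
    rw [← ZMod.intCast_zmod_eq_zero_iff_dvd]
    push_cast
    dsimp only at hf
    have h : (a : ZMod q) - c = x * (b - d) := by linear_combination hf
    rw [h]
    linear_combination -((b : ZMod q) - d) ^ 2 * hx
  have hpos : 0 < ((a : ℤ) - c) ^ 2 + 2 * ((b : ℤ) - d) ^ 2 := by
    by_contra hle
    have h1 : (a : ℤ) - c = 0 := by nlinarith [sq_nonneg ((a : ℤ) - c), sq_nonneg ((b : ℤ) - d)]
    have h2 : (b : ℤ) - d = 0 := by nlinarith [sq_nonneg ((a : ℤ) - c), sq_nonneg ((b : ℤ) - d)]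
    exact hne (Prod.ext (by simp; omega) (by simp; omega))
  have hA : ((a : ℤ) - c) ^ 2 ≤ (s : ℤ) ^ 2 := sq_le_sq' (by omega) (by omega)
  have hB : ((b : ℤ) - d) ^ 2 ≤ (s : ℤ) ^ 2 := sq_le_sq' (by omega) (by omega)
  have hsq' : (s : ℤ) ^ 2 < q := by rw [sq]; exact_mod_cast hsq
  obtain ⟨k, hk⟩ := hdvd
  have hk0 : 0 < k := by
    by_contra h
    nlinarith
  have hk3 : k < 3 := by
    by_contra h
    nlinarith
  refine ⟨a - c, b - d, ?_⟩
  rw [hk]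
  interval_cases k
  · left; ring
  · right; ring

/-- If `q` is a nonzero sum of two squares and `-1` is represented by `A ^ 2 + q B ^ 2`, then `-1`
is a sum of two squares. -/
theorem exists_sq_add_sq_eq_neg_one {F : Type*} [Field F] {q u v A B : F} (hq : q ≠ 0)
    (huv : u ^ 2 + v ^ 2 = q) (hAB : A ^ 2 + q * B ^ 2 = -1) : ∃ a b : F, a ^ 2 + b ^ 2 = -1 := by
  by_cases hB : B = 0
  · exact ⟨A, 0, by simpa [hB] using hAB⟩
  refine ⟨(A * u - v) / (B * q), (A * v + u) / (B * q), ?_⟩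
  field_simp
  linear_combination (A ^ 2 + 1) * huv + q * hAB

theorem exists_prime_modEq_three_and_dvd_add_one {n : ℕ} (hn : Odd n) :
    ∃ q : ℕ, q.Prime ∧ q % 8 = 3 ∧ n ∣ q + 1 := by
  have hn0 : n ≠ 0 := by rintro rfl; simp at hn
  have hcop : Nat.Coprime 8 n := (Nat.Coprime.pow_left 3 (Nat.coprime_two_left.2 hn))
  obtain ⟨r, hr8, hrn⟩ := Nat.chineseRemainder hcop 3 (n - 1)
  have hr8' : r.Coprime 8 := by
    rw [Nat.Coprime, hr8.gcd_eq]; norm_num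
  have hrn' : r.Coprime n := by
    rw [Nat.Coprime, hrn.gcd_eq]
    exact (Nat.coprime_self_sub_left (by omega)).2 (by simp)
  obtain ⟨q, -, hqp, hq⟩ := Nat.forall_exists_prime_gt_and_modEq 0
    (mul_ne_zero (by norm_num) hn0) (Nat.Coprime.mul_right hr8' hrn')
  refine ⟨q, hqp, (hq.of_mul_right n).trans hr8, ?_⟩
  have h : q + 1 ≡ n - 1 + 1 [MOD n] := ((hq.of_mul_left 8).trans hrn).add_right 1
  rw [Nat.sub_add_cancel (by omega)] at h
  exact (Nat.modEq_zero_iff_dvd).1 (h.trans (by simp [Nat.ModEq]))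

theorem exists_sq_add_sq_eq_neg_one_of_sqrt_two {F : Type*} [Field F] [CharZero F] {n : ℕ}
    (hn : 1 < n) (hodd : Odd n) {s z : F} (hs : s ^ 2 = 2) (hz : IsPrimitiveRoot z n) :
    ∃ a b : F, a ^ 2 + b ^ 2 = -1 := by
  obtain ⟨q, hqp, hq8, hqn⟩ := exists_prime_modEq_three_and_dvd_add_one hodd
  have : Fact q.Prime := ⟨hqp⟩
  have hq0 : (q : F) ≠ 0 := Nat.cast_ne_zero.2 hqp.ne_zero
  have hs0 : s ≠ 0 := by rintro rfl; norm_num at hs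
  obtain ⟨u, v, huv⟩ : ∃ u v : F, u ^ 2 + v ^ 2 = q := by
    obtain ⟨a, b, h | h⟩ := exists_sq_add_two_mul_sq_eq q hq8
    · have h' : (a : F) ^ 2 + 2 * (b : F) ^ 2 = q := by
        exact_mod_cast congrArg (Int.cast : ℤ → F) h
      exact ⟨a, s * b, by rw [mul_pow, hs, h']⟩
    · have h' : (a : F) ^ 2 + 2 * (b : F) ^ 2 = 2 * q := by
        exact_mod_cast congrArg (Int.cast : ℤ → F) h
      refine ⟨a / s, b, ?_⟩
      rw [div_pow, hs]
      linear_combination h' / 2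
  obtain ⟨S, D, hSD⟩ := exists_X_sub_one_mul_sq_add_mul_sq q (by omega)
  have hev := congrArg (Polynomial.aeval z) hSD
  simp only [map_mul, map_sub, map_add, map_pow, Polynomial.aeval_X, map_one, map_natCast,
    map_ofNat] at hev
  have hzq : z ^ q * z = 1 := by
    rw [← pow_succ, hz.pow_eq_one_iff_dvd]; exact hqn
  have hz1 : z - 1 ≠ 0 := sub_ne_zero.2 (hz.ne_one hn)
  obtain ⟨m, hm⟩ := hodd
  have hw : (z ^ (m + 1)) ^ 2 = z := by
    rw [← pow_mul, show (m + 1) * 2 = n + 1 by omega, pow_succ, hz.pow_eq_one, one_mul]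
  refine exists_sq_add_sq_eq_neg_one hq0 huv (A := z ^ (m + 1) * Polynomial.aeval z S / 2)
    (B := z ^ (m + 1) * Polynomial.aeval z D / 2) ?_
  rw [div_pow, div_pow, mul_pow, mul_pow, hw]
  refine mul_left_cancel₀ hz1 ?_
  linear_combination z / 4 * hev + hzq

theorem Quaternion.exists_mul_eq_zero_of_sq_add_sq_eq_neg_one {F : Type*} [Field F] {a b : F}
    (h : a ^ 2 + b ^ 2 = -1) : ∃ x y : Quaternion F, x ≠ 0 ∧ y ≠ 0 ∧ x * y = 0 := by
  let x : QuaternionAlgebra F (-1) 0 (-1) := ⟨0, a, b, 1⟩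
  have hne : x ≠ 0 := fun h0 => one_ne_zero (congrArg QuaternionAlgebra.imK h0)
  have hx : x * x = 0 := by
    rw [QuaternionAlgebra.mk_mul_mk]
    ext
    · simp only [QuaternionAlgebra.re_zero]
      linear_combination -h
    · simp only [QuaternionAlgebra.imI_zero]
      ring
    · simp only [QuaternionAlgebra.imJ_zero]
      ring
    · simp only [QuaternionAlgebra.imK_zero]
      ring
  exact ⟨x, x, hne, hne, hx⟩

theorem stmt11 (n : ℕ) (hn : 1 < n) (hodd : Odd n) :
    (∃ a b : sqrt2CycField n, a ^ 2 + b ^ 2 = -1) ∧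
    ∃ x y : Quaternion (sqrt2CycField n), x ≠ 0 ∧ y ≠ 0 ∧ x * y = 0 := by
  have hs : (Real.sqrt 2 : ℂ) ∈ sqrt2CycField n := Subfield.subset_closure (by simp)
  have hz : Complex.exp (2 * Real.pi * Complex.I / n) ∈ sqrt2CycField n :=
    Subfield.subset_closure (by simp)
  have hs2 : (⟨_, hs⟩ : sqrt2CycField n) ^ 2 = 2 := by
    apply Subtype.ext
    change (Real.sqrt 2 : ℂ) ^ 2 = 2
    rw [← Complex.ofReal_pow, Real.sq_sqrt (by norm_num)]
    norm_num
  have hzn : IsPrimitiveRoot (⟨_, hz⟩ : sqrt2CycField n) n :=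
    IsPrimitiveRoot.of_map_of_injective (f := (sqrt2CycField n).subtype)
      (Complex.isPrimitiveRoot_exp n (by omega)) Subtype.val_injective
  obtain ⟨a, b, hab⟩ := exists_sq_add_sq_eq_neg_one_of_sqrt_two hn hodd hs2 hzn
  exact ⟨⟨a, b, hab⟩, Quaternion.exists_mul_eq_zero_of_sq_add_sq_eq_neg_one hab⟩
end

section
/- Let G be a finite group, let N be a nontrivial normal subgroup of G that is a nonideal-kernel witness over ℝ, and let g ∈ G be an element such that ⟨g⟩ is not normal in G. Then g has order 4 and N = ⟨g²⟩; in particular |N| = 2. -/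
open scoped BigOperators

open MonoidAlgebra

theorem aveIdem_mul_single {K G : Type*} [Field K] [Group G] [Finite G] (N : Subgroup G) {n : G}
    (hn : n ∈ N) : aveIdem K N * single n 1 = aveIdem K N := by
  have := Fintype.ofFinite N
  simp only [aveIdem, finsum_eq_sum_of_fintype, smul_mul_assoc, Finset.sum_mul]
  congr 1
  rw [← Equiv.sum_comp (Equiv.mulRight (⟨n, hn⟩ : N)) fun x : N => of K G x]
  simp

theorem IsNKW.mul_single_of_mul_self_eq_zero {K G : Type*} [Field K] [Group G] [Finite G]
    {N : Subgroup G} (h : IsNKW K N) {n : G} (hn : n ∈ N) {x : MonoidAlgebra K G}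
    (hx : x * x = 0) : x * single n 1 = x := by
  have hxe := h x ⟨2, by rw [sq, hx]⟩
  rw [← hxe, mul_assoc, aveIdem_mul_single N hn]

/-- The element `∑ x ∈ C, φ x • x` of the group algebra of `G`. -/
noncomputable def weightedSum {G : Type*} [Group G] (C : Subgroup G) [Fintype C] (φ : G → ℝ) :
    MonoidAlgebra ℝ G :=
  ∑ x : C, single (x : G) (φ x)

section weightedSum

variable {G : Type*} [Group G] (C : Subgroup G) [Fintype C] (φ : G → ℝ)

theorem coeff_weightedSum_of_mem {x : G} (hx : x ∈ C) : (weightedSum C φ).coeff x = φ x := by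
  classical
  simp only [weightedSum, coeff_sum, Finsupp.finsetSum_apply, coeff_single, Finsupp.single_apply]
  rw [Finset.sum_eq_single ⟨x, hx⟩]
  · simp
  · intro b _ hb
    rw [if_neg]
    exact fun h => hb (Subtype.ext h)
  · simp

theorem coeff_weightedSum_of_notMem {x : G} (hx : x ∉ C) : (weightedSum C φ).coeff x = 0 := by
  classical
  simp only [weightedSum, coeff_sum, Finsupp.finsetSum_apply, coeff_single, Finsupp.single_apply]
  refine Finset.sum_eq_zero fun b _ => if_neg ?_
  rintro rfl
  exact hx b.2

theorem weightedSum_one_mul_single {c : G} (hc : c ∈ C) :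
    weightedSum C 1 * single c 1 = weightedSum C 1 := by
  ext v
  rw [coeff_mul_single_apply, mul_one]
  by_cases hv : v ∈ C
  · rw [coeff_weightedSum_of_mem C 1 hv,
      coeff_weightedSum_of_mem C 1 (C.mul_mem hv (C.inv_mem hc))]
    rfl
  · rw [coeff_weightedSum_of_notMem C 1 hv, coeff_weightedSum_of_notMem]
    rwa [C.mul_mem_cancel_right (C.inv_mem hc)]

variable {C φ}

theorem single_mul_weightedSum {c : G} (h : ∀ x ∈ C, c * x = x * c) :
    single c 1 * weightedSum C φ = weightedSum C φ * single c 1 := by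
  simp only [weightedSum, Finset.mul_sum, Finset.sum_mul, single_mul_single, one_mul, mul_one]
  exact Finset.sum_congr rfl fun x _ => by rw [h x x.2]

/-- A solution of d'Alembert's functional equation gives an eigenvector for `y + y⁻¹`. -/
theorem weightedSum_mul_single_add
    (hφ : ∀ x ∈ C, ∀ y ∈ C, φ (x * y) + φ (x * y⁻¹) = 2 * φ x * φ y) {y : G} (hy : y ∈ C) :
    weightedSum C φ * single y 1 + weightedSum C φ * single y⁻¹ 1 =
      (2 * φ y) • weightedSum C φ := by
  ext v
  simp only [coeff_add, Finsupp.add_apply, coeff_mul_single_apply, mul_one, coeff_smul,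
    Finsupp.smul_apply, smul_eq_mul, inv_inv]
  by_cases hv : v ∈ C
  · rw [coeff_weightedSum_of_mem C φ hv, coeff_weightedSum_of_mem C φ (C.mul_mem hv hy),
      coeff_weightedSum_of_mem C φ (C.mul_mem hv (C.inv_mem hy))]
    linarith [hφ v hv y hy]
  · rw [coeff_weightedSum_of_notMem C φ hv, coeff_weightedSum_of_notMem C φ,
      coeff_weightedSum_of_notMem C φ]
    · simp
    · rwa [C.mul_mem_cancel_right hy]
    · rwa [C.mul_mem_cancel_right (C.inv_mem hy)]

theorem weightedSum_mul_self
    (hφ : ∀ x ∈ C, ∀ y ∈ C, φ (x * y) + φ (x * y⁻¹) = 2 * φ x * φ y)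
    (hinv : ∀ x ∈ C, φ x⁻¹ = φ x) :
    weightedSum C φ * weightedSum C φ = (∑ x : C, φ x ^ 2) • weightedSum C φ := by
  have h₁ : weightedSum C φ * weightedSum C φ =
      ∑ x : C, φ x • (weightedSum C φ * single (x : G) 1) := by
    conv_lhs => enter [2]; rw [weightedSum]
    rw [Finset.mul_sum]
    refine Finset.sum_congr rfl fun x _ => ?_
    rw [← mul_smul_comm, smul_single, smul_eq_mul, mul_one]
  have h₂ : weightedSum C φ * weightedSum C φ =
      ∑ x : C, φ x • (weightedSum C φ * single (x : G)⁻¹ 1) := by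
    rw [h₁, ← Equiv.sum_comp (Equiv.inv C)]
    refine Finset.sum_congr rfl fun x _ => ?_
    simp [hinv x x.2]
  have h₃ : (2 : ℝ) • (weightedSum C φ * weightedSum C φ) =
      (2 : ℝ) • ((∑ x : C, φ x ^ 2) • weightedSum C φ) := by
    rw [two_smul]
    nth_rewrite 1 [h₁]
    rw [h₂, ← Finset.sum_add_distrib, smul_smul, Finset.mul_sum, Finset.sum_smul]
    refine Finset.sum_congr rfl fun x _ => ?_
    rw [← smul_add, weightedSum_mul_single_add hφ x.2, smul_smul]
    congr 1
    ring
  exact smul_right_injective _ two_ne_zero h₃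

end weightedSum

/-- A witness is contained in every cyclic subgroup that is not normal. -/
theorem IsNKW.le_zpowers {G : Type*} [Group G] [Finite G] {N : Subgroup G} (hN : IsNKW ℝ N)
    {g h : G} (hg : h⁻¹ * g * h ∉ Subgroup.zpowers g) : N ≤ Subgroup.zpowers g := by
  intro n hn
  set C := Subgroup.zpowers g with hC
  have := Fintype.ofFinite C
  have hgC : g ∈ C := Subgroup.mem_zpowers g
  set s := weightedSum C 1
  have hs : s * single g 1 = s := weightedSum_one_mul_single C hgC
  set x : MonoidAlgebra ℝ G := single h 1 * s - single g 1 * (single h 1 * s) with hx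
  have hxx : x * x = 0 := by
    have : s * x = 0 := by
      rw [hx, mul_sub, ← mul_assoc s (single g 1), hs, sub_self]
    have h₂ : x = (1 - single g 1) * single h 1 * s := by rw [hx]; noncomm_ring
    nth_rewrite 1 [h₂]
    rw [mul_assoc, this, mul_zero]
  have key := congrArg (fun y : MonoidAlgebra ℝ G => y.coeff (h * n))
    (hN.mul_single_of_mul_self_eq_zero hn hxx)
  have hcoeff (v : G) : x.coeff v = s.coeff (h⁻¹ * v) - s.coeff (h⁻¹ * (g⁻¹ * v)) := by
    simp [hx, coeff_sub, coeff_single_mul_apply]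
  have hmem : h⁻¹ * (g⁻¹ * h) ∉ C := by
    intro hm
    apply hg
    simpa [mul_assoc] using C.inv_mem hm
  by_contra hnC
  simp only [coeff_mul_single_apply, mul_inv_cancel_right, mul_one, hcoeff,
    inv_mul_cancel, inv_mul_cancel_left] at key
  have h1 : s.coeff 1 = 1 := coeff_weightedSum_of_mem C 1 C.one_mem
  rw [h1, coeff_weightedSum_of_notMem C 1 hmem, coeff_weightedSum_of_notMem C 1 hnC] at key
  by_cases h₃ : h⁻¹ * (g⁻¹ * (h * n)) ∈ C
  · rw [coeff_weightedSum_of_mem C 1 h₃] at key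
    norm_num at key
  · rw [coeff_weightedSum_of_notMem C 1 h₃] at key
    norm_num at key

/-- There is a function on `G` sending every `g ^ k` to `cos (2 π k / orderOf g)`. -/
theorem exists_cos_zpowers {G : Type*} [Group G] (g : G) :
    ∃ φ : G → ℝ, ∀ k : ℤ, φ (g ^ k) = Real.cos (2 * Real.pi * k / orderOf g) := by
  classical
  refine ⟨fun x => if h : ∃ k : ℤ, g ^ k = x then
    Real.cos (2 * Real.pi * h.choose / orderOf g) else 0, fun k => ?_⟩
  have h : ∃ l : ℤ, g ^ l = g ^ k := ⟨k, rfl⟩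
  simp only [dif_pos h]
  obtain ⟨m, hm⟩ := orderOf_dvd_sub_iff_zpow_eq_zpow.mpr h.choose_spec
  rcases eq_or_ne (orderOf g) 0 with h0 | h0
  · simp [h0]
  have hr : (orderOf g : ℝ) ≠ 0 := by exact_mod_cast h0
  have hm' : ((h.choose : ℤ) : ℝ) = k + orderOf g * m := by
    rw [eq_comm, ← eq_sub_iff_add_eq', eq_comm]; exact_mod_cast hm
  rw [hm', ← Real.cos_add_int_mul_two_pi (2 * Real.pi * k / orderOf g) m]
  congr 1
  field_simp

theorem eq_four_of_cos_two_pi_div_eq_zero {n : ℕ} (hn : n ≠ 0)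
    (h : Real.cos (2 * Real.pi / n) = 0) : n = 4 := by
  obtain ⟨k, hk⟩ := Real.cos_eq_zero_iff.mp h
  have hr : (n : ℝ) ≠ 0 := by exact_mod_cast hn
  have hpi := Real.pi_ne_zero
  field_simp at hk
  have hk' : (4 : ℤ) = n * (2 * k + 1) := by
    have : (4 : ℝ) = n * (2 * k + 1) := by linarith
    exact_mod_cast this
  have hle : n ≤ 4 := by
    have : (n : ℤ) ∣ 4 := ⟨_, hk'⟩
    exact Nat.le_of_dvd (by norm_num) (by exact_mod_cast this)
  interval_cases n <;> omega

/-- If a witness is contained in a commutative subgroup `C`, then the weighted sum over `C` of an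
even solution of d'Alembert's equation that is not identically `1` on the witness is central. -/
theorem IsNKW.commute_weightedSum {G : Type*} [Group G] [Finite G] {N : Subgroup G} [N.Normal]
    (hN : IsNKW ℝ N) {C : Subgroup G} [Fintype C] {φ : G → ℝ} (hNC : N ≤ C)
    (hcomm : ∀ x ∈ C, ∀ y ∈ C, x * y = y * x)
    (hφ : ∀ x ∈ C, ∀ y ∈ C, φ (x * y) + φ (x * y⁻¹) = 2 * φ x * φ y)
    (hinv : ∀ x ∈ C, φ x⁻¹ = φ x) (hone : φ 1 = 1) {n : G} (hn : n ∈ N) (hφn : φ n ≠ 1) (h : G) :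
    single h 1 * weightedSum C φ = weightedSum C φ * single h 1 := by
  set a := weightedSum C φ
  set c : ℝ := ∑ x : C, φ x ^ 2
  have hc : c ≠ 0 := by
    refine (Finset.sum_pos' (fun _ _ => sq_nonneg _) ⟨(1 : C), Finset.mem_univ _, ?_⟩).ne'
    simp [hone]
  have haa : a * a = c • a := weightedSum_mul_self hφ hinv
  have hshift : a * single n 1 + a * single n⁻¹ 1 = (2 * φ n) • a :=
    weightedSum_mul_single_add hφ (hNC hn)
  have hvanish {x : MonoidAlgebra ℝ G} (hx : x + x = (2 * φ n) • x) : x = 0 := by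
    have : (2 - 2 * φ n) • x = 0 := by rw [sub_smul, two_smul, hx, sub_self]
    exact (smul_eq_zero.mp this).resolve_left fun h0 => hφn (by linarith)
  have hl : c • (single h 1 * a) = a * single h 1 * a := by
    rw [← sub_eq_zero]
    set x := c • (single h 1 * a) - a * single h 1 * a with hx
    have hxx : x * x = 0 := by
      have : a * x = 0 := by
        rw [hx, mul_sub, mul_smul_comm, ← mul_assoc a (a * single h 1), ← mul_assoc a a, haa]
        simp [mul_assoc]
      have h₂ : x = (c • single h 1 - a * single h 1) * a := by
        rw [hx, sub_mul, smul_mul_assoc]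
      nth_rewrite 1 [h₂]
      rw [mul_assoc, this, mul_zero]
    have h₁ := hN.mul_single_of_mul_self_eq_zero hn hxx
    have h₂ := hN.mul_single_of_mul_self_eq_zero (N.inv_mem hn) hxx
    apply hvanish
    nth_rewrite 1 [← h₁]
    nth_rewrite 2 [← h₂]
    have h₃ : x = (c • single h 1 - a * single h 1) * a := by
      rw [hx, sub_mul, smul_mul_assoc]
    rw [h₃, mul_assoc, mul_assoc, ← mul_add, hshift, mul_smul_comm]
  have hr : c • (a * single h 1) = a * single h 1 * a := by
    rw [← sub_eq_zero]
    set x := c • (a * single h 1) - a * single h 1 * a with hx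
    have hxa : x * a = 0 := by
      rw [hx, sub_mul, smul_mul_assoc, mul_assoc _ a a, haa, mul_smul_comm, sub_self]
    have hxx : x * x = 0 := by
      nth_rewrite 2 [hx]
      rw [mul_sub, mul_smul_comm, mul_assoc a, ← mul_assoc x a, ← mul_assoc x a, hxa]
      simp
    have hconj {m : G} (hm : m ∈ N) : x = c • (a * single m 1 * single h 1) -
        a * single m 1 * single h 1 * a := by
      have hm' : h⁻¹ * m * h ∈ N := by
        simpa using ‹N.Normal›.conj_mem m hm h⁻¹
      have hma : single (h⁻¹ * m * h) 1 * a = a * single (h⁻¹ * m * h) 1 :=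
        single_mul_weightedSum fun y hy => hcomm _ (hNC hm') y hy
      have hmh : (single h 1 * single (h⁻¹ * m * h) 1 : MonoidAlgebra ℝ G) =
          single m 1 * single h 1 := by
        simp [single_mul_single, mul_assoc]
      rw [← hN.mul_single_of_mul_self_eq_zero hm' hxx, hx, sub_mul, smul_mul_assoc,
        mul_assoc _ a, ← hma, ← mul_assoc _ _ a, mul_assoc a, hmh, mul_assoc a (single m 1)]
    apply hvanish
    nth_rewrite 1 [hconj hn]
    nth_rewrite 1 [hconj (N.inv_mem hn)]
    have : (2 * φ n) • x = c • (((2 * φ n) • a) * single h 1) -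
        ((2 * φ n) • a) * single h 1 * a := by
      rw [hx, smul_sub, smul_comm, smul_mul_assoc, smul_mul_assoc]
    rw [this, ← hshift, add_mul, add_mul, smul_add]
    abel
  exact smul_right_injective _ hc (hl.trans hr.symm)

theorem stmt12 (G : Type*) [Group G] [Finite G] (N : Subgroup G) (hN : N.Normal)
    (hne : N ≠ ⊥) (hNKW : IsNKW ℝ N) (g : G) (hg : ¬ (Subgroup.zpowers g).Normal) :
    orderOf g = 4 ∧ N = Subgroup.zpowers (g ^ 2) ∧ Nat.card N = 2 := by
  have hconj : ∃ h : G, h * g * h⁻¹ ∉ Subgroup.zpowers g := by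
    by_contra! hall
    refine hg ⟨fun x hx h => ?_⟩
    obtain ⟨k, rfl⟩ := hx
    have := (Subgroup.zpowers g).zpow_mem (hall h) k
    rwa [conj_zpow] at this
  obtain ⟨h, hh⟩ := hconj
  have hNC : N ≤ Subgroup.zpowers g := hNKW.le_zpowers (h := h⁻¹) (by simpa using hh)
  have hord : orderOf g ≠ 0 := (orderOf_pos g).ne'
  have hordR : (orderOf g : ℝ) ≠ 0 := by exact_mod_cast hord
  have := Fintype.ofFinite (Subgroup.zpowers g)
  obtain ⟨φ, hφ⟩ := exists_cos_zpowers g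
  obtain ⟨n, hn, hn1⟩ := N.bot_or_exists_ne_one.resolve_left hne
  have hφn : φ n ≠ 1 := by
    obtain ⟨k, rfl⟩ := hNC hn
    intro h1
    simp only [hφ] at h1
    obtain ⟨m, hm⟩ := (Real.cos_eq_one_iff _).mp h1
    have hpi := Real.pi_ne_zero
    field_simp at hm
    refine hn1 (orderOf_dvd_iff_zpow_eq_one.mp ⟨m, ?_⟩)
    have : (k : ℝ) = orderOf g * m := by linarith
    exact_mod_cast this
  have hcentral := hNKW.commute_weightedSum (φ := φ) hNC
    (by
      rintro _ ⟨k, rfl⟩ _ ⟨l, rfl⟩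
      exact zpow_mul_comm g k l)
    (by
      rintro _ ⟨k, rfl⟩ _ ⟨l, rfl⟩
      simp only [← zpow_add, ← zpow_neg, hφ]
      push_cast
      rw [mul_add, mul_add, add_div, add_div, mul_neg, neg_div, Real.cos_add, Real.cos_add,
        Real.cos_neg, Real.sin_neg]
      ring)
    (by
      rintro _ ⟨k, rfl⟩
      simp only [← zpow_neg, hφ]
      push_cast
      rw [mul_neg, neg_div, Real.cos_neg])
    (by simpa using hφ 0) hn hφn h
  have hφg : φ g = 0 := by
    have := congrArg (fun y : MonoidAlgebra ℝ G => y.coeff (h * g)) hcentral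
    simp only [coeff_single_mul_apply, coeff_mul_single_apply, inv_mul_cancel_left, one_mul,
      mul_one] at this
    rwa [coeff_weightedSum_of_mem _ _ (Subgroup.mem_zpowers g),
      coeff_weightedSum_of_notMem _ _ hh] at this
  have h4 : orderOf g = 4 := by
    refine eq_four_of_cos_two_pi_div_eq_zero hord ?_
    have := hφ 1
    rw [zpow_one, hφg] at this
    simpa using this.symm
  have hg4 : g ^ 4 = 1 := h4 ▸ pow_orderOf_eq_one g
  have hg2 : orderOf (g ^ 2) = 2 := by
    rw [orderOf_pow, h4]
    norm_num
  have hgN : g ∉ N := fun hgN => hg (by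
    rwa [← le_antisymm hNC (Subgroup.zpowers_le.mpr hgN)])
  classical
  have hcases : ∀ m ∈ N, m = 1 ∨ m = g ^ 2 := by
    intro m hm
    obtain ⟨k, hk, rfl⟩ := (mem_zpowers_iff_mem_range_orderOf.mp (hNC hm)) |> Finset.mem_image.mp
    rw [h4, Finset.mem_range] at hk
    interval_cases k
    · simp
    · exact absurd (by simpa using hm) hgN
    · simp
    · refine absurd ?_ hgN
      have hinv : g = (g ^ 3)⁻¹ := by
        rw [eq_inv_iff_mul_eq_one, ← pow_succ', hg4]
      rw [hinv]
      exact N.inv_mem hm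
  have hNeq : N = Subgroup.zpowers (g ^ 2) := by
    refine le_antisymm (fun m hm => ?_) (Subgroup.zpowers_le.mpr ?_)
    · rcases hcases m hm with rfl | rfl
      · exact Subgroup.one_mem _
      · exact Subgroup.mem_zpowers _
    · exact (hcases n hn).resolve_left hn1 ▸ hn
  exact ⟨h4, hNeq, by rw [hNeq, Nat.card_zpowers, hg2]⟩
end
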